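/- arXiv:1304.0188 — 2 statements merged into one kernel-verified Lean document; each statement's English description precedes it below -/
import Mathlib

section
/- For every real ε with 0 < ε < 1/4 there exists N such that for every integer n ≥ N there exist distinct primes p and q, both lying in the interval [n^(1/4−ε), 2·n^(1/4−ε)], and a prime r with n/4 ≤ r ≤ n/2, such that r ≡ n (mod p) and r ≡ 1 (mod q). -/
open Finset

/-- The additive character `x ↦ exp (2 π i x)` of the real line. -/
noncomputable def expTwoPi (x : ℝ) : ℂ := Complex.exp (2 * Real.pi * x * Complex.I)

lemma expTwoPi_add (x y : ℝ) : expTwoPi (x + y) = expTwoPi x * expTwoPi y := by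
  simp only [expTwoPi]; rw [← Complex.exp_add]; push_cast; ring_nf

lemma norm_expTwoPi (x : ℝ) : ‖expTwoPi x‖ = 1 := by
  have := Complex.norm_exp_ofReal_mul_I (2 * Real.pi * x)
  simpa [expTwoPi] using this

lemma conj_expTwoPi (x : ℝ) : (starRingEnd ℂ) (expTwoPi x) = expTwoPi (-x) := by
  simp only [expTwoPi]; rw [← Complex.exp_conj]; simp [Complex.conj_ofNat]

lemma expTwoPi_natCast_mul (m : ℕ) (x : ℝ) : expTwoPi (m * x) = expTwoPi x ^ m := by
  simp only [expTwoPi]; rw [← Complex.exp_nat_mul]; push_cast; ring_nf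

lemma expTwoPi_intCast (k : ℤ) : expTwoPi k = 1 := by
  simp only [expTwoPi]
  rw [Complex.exp_eq_one_iff]; exact ⟨k, by push_cast; ring⟩

lemma expTwoPi_fract (x : ℝ) : expTwoPi (Int.fract x) = expTwoPi x := by
  conv_rhs => rw [← Int.fract_add_floor x]
  rw [expTwoPi_add, expTwoPi_intCast, mul_one]

lemma two_mul_le_sin_pi_mul {t x : ℝ} (ht : 0 ≤ t) (h1 : t ≤ x) (h2 : x ≤ 1 - t) :
    2 * t ≤ Real.sin (Real.pi * x) := by
  have hpi := Real.pi_pos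
  rcases le_total x (1 / 2) with h | h
  · have := Real.mul_le_sin (x := Real.pi * x) (by nlinarith) (by nlinarith)
    have e : 2 / Real.pi * (Real.pi * x) = 2 * x := by field_simp
    linarith
  · have := Real.mul_le_sin (x := Real.pi * (1 - x)) (by nlinarith) (by nlinarith)
    have e : 2 / Real.pi * (Real.pi * (1 - x)) = 2 * (1 - x) := by field_simp
    rw [show Real.pi * (1 - x) = Real.pi - Real.pi * x by ring, Real.sin_pi_sub] at this
    rw [show Real.pi - Real.pi * x = Real.pi * (1 - x) by ring] at this
    linarith

lemma norm_sum_expTwoPi_le {t β : ℝ} (ht : 0 < t) (h1 : t ≤ Int.fract β)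
    (h2 : Int.fract β ≤ 1 - t) (N : ℕ) :
    ‖∑ m ∈ range N, expTwoPi (m * β)‖ ≤ 1 / (2 * t) := by
  have hz : 4 * t ≤ ‖expTwoPi β - 1‖ := by
    rw [← expTwoPi_fract]
    have h := Complex.norm_exp_I_mul_ofReal_sub_one (2 * Real.pi * Int.fract β)
    have e : expTwoPi (Int.fract β) = Complex.exp (Complex.I * ↑(2 * Real.pi * Int.fract β)) := by
      simp only [expTwoPi]; push_cast; ring_nf
    rw [e, h, show 2 * Real.pi * Int.fract β / 2 = Real.pi * Int.fract β by ring]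
    have := two_mul_le_sin_pi_mul ht.le h1 h2
    refine le_trans ?_ (le_abs_self _)
    linarith
  have hg : (∑ m ∈ range N, expTwoPi (m * β)) * (expTwoPi β - 1) = expTwoPi β ^ N - 1 := by
    simp_rw [expTwoPi_natCast_mul]; exact geom_sum_mul _ _
  have hn : ‖∑ m ∈ range N, expTwoPi (m * β)‖ * ‖expTwoPi β - 1‖ ≤ 2 := by
    rw [← norm_mul, hg]
    refine (norm_sub_le _ _).trans ?_
    rw [norm_pow, norm_expTwoPi]; norm_num
  rw [le_div_iff₀ (by positivity)]
  nlinarith [norm_nonneg (∑ m ∈ range N, expTwoPi (m * β))]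

lemma sum_range_div_le (D : ℕ) :
    ∑ n ∈ range D, ((D : ℝ) / (2 * n) + D / (2 * ((D - 1 - n : ℕ) : ℝ))) ≤
      D * (1 + Real.log D) := by
  rw [sum_add_distrib]
  have h2 : ∑ n ∈ range D, (D : ℝ) / (2 * ((D - 1 - n : ℕ) : ℝ)) =
      ∑ n ∈ range D, (D : ℝ) / (2 * n) :=
    Finset.sum_range_reflect (fun n => (D : ℝ) / (2 * (n : ℝ))) D
  rw [h2, ← two_mul]
  have h3 : ∑ n ∈ range D, (D : ℝ) / (2 * n) = D / 2 * ∑ n ∈ range D, ((n : ℝ))⁻¹ := by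
    rw [mul_sum]; refine sum_congr rfl fun n _ => ?_
    rw [div_eq_mul_inv, mul_inv]; ring
  have h4 : ∑ n ∈ range D, ((n : ℝ))⁻¹ ≤ 1 + Real.log D := by
    refine le_trans ?_ (harmonic_le_one_add_log D)
    rw [harmonic]; push_cast
    cases D with
    | zero => simp
    | succ D =>
      rw [Finset.sum_range_succ']
      simp only [Nat.cast_zero, inv_zero, add_zero]
      rw [Finset.sum_range_succ]
      push_cast
      have : (0 : ℝ) ≤ ((D : ℝ) + 1)⁻¹ := by positivity
      linarith
  rw [h3]
  nlinarith [Nat.cast_nonneg (α := ℝ) D]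

lemma sum_norm_sum_expTwoPi_le {ι : Type*} (s : Finset ι) (α : ι → ℝ) (D : ℕ) (hD : 0 < D)
    (hα : ∀ i ∈ s, ∀ j ∈ s, i ≠ j → ∀ z : ℤ, 1 / (D : ℝ) ≤ |α i - α j - z|) (β : ℝ) (N : ℕ) :
    ∑ j ∈ s, ‖∑ m ∈ range N, expTwoPi (m * (α j - β))‖ ≤ 2 * N + D * (1 + Real.log D) := by
  have hD' : (0 : ℝ) < D := by exact_mod_cast hD
  set ν : ι → ℕ := fun j => ⌊D * Int.fract (α j - β)⌋₊ with hν
  have hlow (j : ι) : (ν j : ℝ) ≤ D * Int.fract (α j - β) :=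
    Nat.floor_le (mul_nonneg hD'.le (Int.fract_nonneg _))
  have hup (j : ι) : D * Int.fract (α j - β) < ν j + 1 := Nat.lt_floor_add_one _
  have hlt (j : ι) : ν j < D := by
    have : (ν j : ℝ) < D := (hlow j).trans_lt (by nlinarith [Int.fract_lt_one (α j - β)])
    exact_mod_cast this
  have hinj : Set.InjOn ν s := by
    intro i hi j hj hij
    by_contra hne
    have h := hα i hi j hj hne (⌊α i - β⌋ - ⌊α j - β⌋)
    have e : α i - α j - ((⌊α i - β⌋ - ⌊α j - β⌋ : ℤ) : ℝ)
        = Int.fract (α i - β) - Int.fract (α j - β) := by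
      simp only [Int.fract]; push_cast; ring
    rw [e, div_le_iff₀ hD'] at h
    have h1 := hlow i; have h2 := hlow j; have h3 := hup i; have h4 := hup j
    rw [hij] at h1 h3
    have : |Int.fract (α i - β) - Int.fract (α j - β)| * D < 1 := by
      rw [← abs_of_pos hD', ← abs_mul, abs_lt]
      constructor <;> nlinarith
    linarith
  set F : ℕ → ℝ := fun n => ((if n = 0 then (N : ℝ) else 0) + (if n = D - 1 then (N : ℝ) else 0)) +
    ((D : ℝ) / (2 * n) + D / (2 * ((D - 1 - n : ℕ) : ℝ))) with hF
  have hFnn (n : ℕ) : 0 ≤ F n := by simp only [hF]; positivity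
  have hb (j : ι) : ‖∑ m ∈ range N, expTwoPi (m * (α j - β))‖ ≤ F (ν j) := by
    have htriv : ‖∑ m ∈ range N, expTwoPi (m * (α j - β))‖ ≤ N := by
      refine (norm_sum_le _ _).trans ?_
      simp [norm_expTwoPi]
    by_cases h0 : ν j = 0
    · refine htriv.trans ?_
      simp only [hF, h0, if_true]
      have : (0 : ℝ) ≤ (if 0 = D - 1 then (N : ℝ) else 0) := by positivity
      have : (0 : ℝ) ≤ (D : ℝ) / (2 * (0 : ℕ)) + D / (2 * ((D - 1 - 0 : ℕ) : ℝ)) := by positivity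
      linarith
    by_cases h1 : ν j = D - 1
    · refine htriv.trans ?_
      simp only [hF, h1, if_true]
      have : (0 : ℝ) ≤ (if D - 1 = 0 then (N : ℝ) else 0) := by positivity
      have : (0 : ℝ) ≤ (D : ℝ) / (2 * (D - 1 : ℕ)) + D / (2 * ((D - 1 - (D - 1) : ℕ) : ℝ)) := by
        positivity
      linarith
    have hlt' := hlt j
    set k := ν j
    set l := D - 1 - k with hl
    have hk : (0 : ℝ) < k := by exact_mod_cast Nat.pos_of_ne_zero h0
    have hlpos : 0 < l := by omega
    have hl' : (0 : ℝ) < l := by exact_mod_cast hlpos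
    have hsum : (l : ℝ) + k + 1 = D := by
      have : l + k + 1 = D := by omega
      exact_mod_cast this
    have key : ‖∑ m ∈ range N, expTwoPi (m * (α j - β))‖ ≤ 1 / (2 * (min (k : ℝ) l / D)) := by
      refine norm_sum_expTwoPi_le (by positivity) ?_ ?_ N
      · rw [div_le_iff₀ hD']
        have := hlow j
        nlinarith [min_le_left (k : ℝ) l]
      · rw [le_sub_iff_add_le, ← le_sub_iff_add_le', div_le_iff₀ hD']
        have := hup j
        nlinarith [min_le_right (k : ℝ) l]
    refine key.trans ?_
    simp only [hF, h0, h1, if_false, zero_add]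
    rcases le_total (k : ℝ) l with h | h
    · rw [min_eq_left h]
      have e : 1 / (2 * ((k : ℝ) / D)) = D / (2 * k) := by field_simp
      rw [e]
      have : (0 : ℝ) ≤ (D : ℝ) / (2 * l) := by positivity
      linarith
    · rw [min_eq_right h]
      have e : 1 / (2 * ((l : ℝ) / D)) = D / (2 * l) := by field_simp
      rw [e]
      have : (0 : ℝ) ≤ (D : ℝ) / (2 * k) := by positivity
      linarith
  calc ∑ j ∈ s, ‖∑ m ∈ range N, expTwoPi (m * (α j - β))‖
      ≤ ∑ j ∈ s, F (ν j) := sum_le_sum fun j _ => hb j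
    _ = ∑ n ∈ s.image ν, F n := (sum_image hinj).symm
    _ ≤ ∑ n ∈ range D, F n := by
        refine sum_le_sum_of_subset_of_nonneg ?_ fun n _ _ => hFnn n
        intro n hn
        obtain ⟨j, _, rfl⟩ := mem_image.1 hn
        exact mem_range.2 (hlt j)
    _ ≤ 2 * N + D * (1 + Real.log D) := by
        simp only [hF]
        rw [sum_add_distrib]
        refine add_le_add ?_ (sum_range_div_le D)
        rw [sum_add_distrib, sum_ite_eq', sum_ite_eq']
        have : (0 : ℝ) ≤ N := Nat.cast_nonneg N
        split_ifs <;> linarith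

/-- The dual form of the large sieve inequality. -/
lemma sum_norm_sq_dual_le {ι : Type*} (s : Finset ι) (α : ι → ℝ) (D : ℕ) (hD : 0 < D)
    (hα : ∀ i ∈ s, ∀ j ∈ s, i ≠ j → ∀ z : ℤ, 1 / (D : ℝ) ≤ |α i - α j - z|) (c : ι → ℂ) (N : ℕ) :
    ∑ m ∈ range N, ‖∑ i ∈ s, c i * expTwoPi (m * α i)‖ ^ 2 ≤
      (2 * N + D * (1 + Real.log D)) * ∑ i ∈ s, ‖c i‖ ^ 2 := by
  set B := 2 * (N : ℝ) + D * (1 + Real.log D)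
  set G : ι → ι → ℂ := fun i j => ∑ m ∈ range N, expTwoPi (m * (α i - α j)) with hG
  have hGsymm (i j : ι) : ‖G i j‖ = ‖G j i‖ := by
    rw [← Complex.norm_conj (G j i)]
    congr 1
    simp only [hG, map_sum, conj_expTwoPi]
    refine sum_congr rfl fun m _ => ?_
    congr 1; ring
  have hexp : ((∑ m ∈ range N, ‖∑ i ∈ s, c i * expTwoPi (m * α i)‖ ^ 2 : ℝ) : ℂ) =
      ∑ i ∈ s, ∑ j ∈ s, c i * (starRingEnd ℂ) (c j) * G i j := by
    push_cast
    simp_rw [← Complex.mul_conj', map_sum, map_mul, conj_expTwoPi, sum_mul_sum, hG, mul_sum]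
    rw [sum_comm]
    refine sum_congr rfl fun i _ => ?_
    rw [sum_comm]
    refine sum_congr rfl fun j _ => sum_congr rfl fun m _ => ?_
    rw [show (m : ℝ) * (α i - α j) = m * α i + -(m * α j) by ring, expTwoPi_add]
    ring
  have hle : ∑ m ∈ range N, ‖∑ i ∈ s, c i * expTwoPi (m * α i)‖ ^ 2 ≤
      ∑ i ∈ s, ∑ j ∈ s, ‖c i‖ * ‖c j‖ * ‖G i j‖ := by
    have h0 : 0 ≤ ∑ m ∈ range N, ‖∑ i ∈ s, c i * expTwoPi (m * α i)‖ ^ 2 := by positivity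
    rw [← Complex.norm_of_nonneg h0, hexp]
    refine (norm_sum_le _ _).trans (sum_le_sum fun i _ => (norm_sum_le _ _).trans
      (sum_le_sum fun j _ => ?_))
    rw [norm_mul, norm_mul, Complex.norm_conj]
  have hrow (j : ι) : ∑ i ∈ s, ‖G i j‖ ≤ B := sum_norm_sum_expTwoPi_le s α D hD hα (α j) N
  calc _ ≤ ∑ i ∈ s, ∑ j ∈ s, ‖c i‖ * ‖c j‖ * ‖G i j‖ := hle
    _ ≤ ∑ i ∈ s, ∑ j ∈ s, (‖c i‖ ^ 2 / 2 * ‖G j i‖ + ‖c j‖ ^ 2 / 2 * ‖G i j‖) := by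
        refine sum_le_sum fun i _ => sum_le_sum fun j _ => ?_
        rw [hGsymm j i]
        nlinarith [mul_nonneg (norm_nonneg (G i j)) (sq_nonneg (‖c i‖ - ‖c j‖))]
    _ = ∑ i ∈ s, ‖c i‖ ^ 2 * ∑ j ∈ s, ‖G j i‖ := by
        simp_rw [sum_add_distrib]
        rw [sum_comm (f := fun i j => ‖c j‖ ^ 2 / 2 * ‖G i j‖), ← sum_add_distrib]
        refine sum_congr rfl fun i _ => ?_
        rw [mul_sum, ← sum_add_distrib]
        refine sum_congr rfl fun j _ => ?_
        ring
    _ ≤ ∑ i ∈ s, ‖c i‖ ^ 2 * B :=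
        sum_le_sum fun i _ => mul_le_mul_of_nonneg_left (hrow i) (by positivity)
    _ = _ := by rw [← sum_mul, mul_comm]

/-- The large sieve inequality, up to a logarithmic factor. -/
theorem large_sieve {ι : Type*} (s : Finset ι) (α : ι → ℝ) (D : ℕ) (hD : 0 < D)
    (hα : ∀ i ∈ s, ∀ j ∈ s, i ≠ j → ∀ z : ℤ, 1 / (D : ℝ) ≤ |α i - α j - z|) (a : ℕ → ℂ) (N : ℕ) :
    ∑ i ∈ s, ‖∑ m ∈ range N, a m * expTwoPi (m * α i)‖ ^ 2 ≤
      (2 * N + D * (1 + Real.log D)) * ∑ m ∈ range N, ‖a m‖ ^ 2 := by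
  set B := 2 * (N : ℝ) + D * (1 + Real.log D)
  set S : ι → ℂ := fun i => ∑ m ∈ range N, a m * expTwoPi (m * α i) with hS
  set X := ∑ i ∈ s, ‖S i‖ ^ 2 with hX
  set Y := ∑ m ∈ range N, ‖a m‖ ^ 2
  have hX0 : 0 ≤ X := by positivity
  have hXc : (X : ℂ) = ∑ m ∈ range N,
      a m * ∑ i ∈ s, (starRingEnd ℂ) (S i) * expTwoPi (m * α i) := by
    simp only [hX]
    push_cast
    simp_rw [← Complex.mul_conj', mul_sum]
    rw [sum_comm]
    refine sum_congr rfl fun i _ => ?_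
    conv_lhs => rw [hS]
    simp only
    rw [sum_mul]
    exact sum_congr rfl fun m _ => by ring
  have h1 : X ≤ ∑ m ∈ range N, ‖a m‖ * ‖∑ i ∈ s, (starRingEnd ℂ) (S i) * expTwoPi (m * α i)‖ := by
    rw [← Complex.norm_of_nonneg hX0, hXc]
    exact (norm_sum_le _ _).trans (le_of_eq (sum_congr rfl fun m _ => norm_mul _ _))
  have h2 : X ^ 2 ≤ Y * (B * X) := by
    refine (pow_le_pow_left₀ hX0 h1 2).trans ((sum_mul_sq_le_sq_mul_sq _ _ _).trans ?_)
    refine mul_le_mul_of_nonneg_left ?_ (by positivity)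
    have := sum_norm_sq_dual_le s α D hD hα (fun i => (starRingEnd ℂ) (S i)) N
    simpa [Complex.norm_conj] using this
  rcases hX0.eq_or_lt with h | h
  · rw [← h]
    have hlog : 0 ≤ Real.log D := Real.log_natCast_nonneg D
    positivity
  · have : X * X ≤ (B * Y) * X := by nlinarith
    exact le_of_mul_le_mul_right this h

/-- The indicator function of the unit residue class `u` modulo `p`, minus its mean value over the
units. -/
noncomputable def unitKernel (p : ℕ) (x : ZMod p) (u : (ZMod p)ˣ) : ℝ :=
  (if x = u then 1 else 0) - (if x = 0 then 0 else 1 / ((p : ℝ) - 1))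

section unitKernel

variable {p : ℕ} [Fact p.Prime]

lemma card_units_cast : (Fintype.card (ZMod p)ˣ : ℝ) = (p : ℝ) - 1 := by
  rw [ZMod.card_units, Nat.cast_pred (Fact.out : p.Prime).pos]

lemma cast_sub_one_pos : (0 : ℝ) < (p : ℝ) - 1 := by
  have : (1 : ℝ) < p := by exact_mod_cast (Fact.out : p.Prime).one_lt
  linarith

lemma unitKernel_zero (u : (ZMod p)ˣ) : unitKernel p 0 u = 0 := by
  simp [unitKernel, u.ne_zero.symm]

lemma unitKernel_coe (x u : (ZMod p)ˣ) :
    unitKernel p x u = (if x = u then 1 else 0) - 1 / ((p : ℝ) - 1) := by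
  simp [unitKernel, x.ne_zero, Units.ext_iff]

lemma eq_zero_or_eq_unit (x : ZMod p) : x = 0 ∨ ∃ u : (ZMod p)ˣ, x = u := by
  rcases eq_or_ne x 0 with h | h
  · exact Or.inl h
  · exact Or.inr ⟨Units.mk0 x h, rfl⟩

/-- The kernel is idempotent with respect to multiplicative convolution. -/
lemma unitKernel_mul (x y : ZMod p) (c : (ZMod p)ˣ) :
    unitKernel p (x * y) c = ∑ u, unitKernel p x u * unitKernel p y (c * u⁻¹) := by
  rcases eq_zero_or_eq_unit x with rfl | ⟨x, rfl⟩
  · simp [unitKernel_zero]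
  rcases eq_zero_or_eq_unit y with rfl | ⟨y, rfl⟩
  · simp [unitKernel_zero]
  have hp := (cast_sub_one_pos (p := p)).ne'
  rw [← Units.val_mul]
  simp only [unitKernel_coe, sub_mul, mul_sub, sum_sub_distrib]
  have e (u : (ZMod p)ˣ) : (y = c * u⁻¹) ↔ (u = y⁻¹ * c) := by
    rw [eq_mul_inv_iff_mul_eq, eq_inv_mul_iff_mul_eq]
  have e2 : (y = c * x⁻¹) ↔ (x * y = c) := by
    rw [eq_mul_inv_iff_mul_eq, mul_comm]
  simp only [ite_mul, one_mul, zero_mul, sum_ite_eq, mem_univ, if_true, mul_ite, mul_one, mul_zero,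
    e, sum_ite_eq', sum_const, card_univ, nsmul_eq_mul, card_units_cast]
  simp only [← e, e2]
  field_simp
  ring

lemma unitKernel_mul_unit (b : (ZMod p)ˣ) (x : ZMod p) (c : (ZMod p)ˣ) :
    unitKernel p (b * x) c = unitKernel p x (b⁻¹ * c) := by
  rcases eq_zero_or_eq_unit x with rfl | ⟨x, rfl⟩
  · simp [unitKernel_zero]
  · rw [← Units.val_mul]
    simp only [unitKernel_coe, eq_inv_mul_iff_mul_eq]

lemma sum_zmod_eq_sum_units_add (F : ZMod p → ℝ) : ∑ x, F x = F 0 + ∑ u : (ZMod p)ˣ, F u := by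
  classical
  rw [← add_sum_erase univ F (mem_univ 0)]
  congr 1
  refine (sum_bij (fun (u : (ZMod p)ˣ) _ => (u : ZMod p)) ?_ ?_ ?_ ?_).symm
  · intro u _; simp [u.ne_zero]
  · intro u _ v _ h; exact Units.ext h
  · intro x hx; exact ⟨Units.mk0 x (by simpa using hx), mem_univ _, rfl⟩
  · intro u _; rfl

lemma sum_unitKernel (u : (ZMod p)ˣ) : ∑ x, unitKernel p x u = 0 := by
  have hp := (cast_sub_one_pos (p := p)).ne'
  rw [sum_zmod_eq_sum_units_add, unitKernel_zero]
  simp only [unitKernel_coe, sum_sub_distrib, sum_ite_eq', mem_univ, if_true, sum_const, card_univ,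
    nsmul_eq_mul, card_units_cast]
  field_simp; ring

lemma sum_abs_unitKernel_le (u : (ZMod p)ˣ) : ∑ x, |unitKernel p x u| ≤ 2 := by
  have hp := cast_sub_one_pos (p := p)
  rw [sum_zmod_eq_sum_units_add (fun x => |unitKernel p x u|), unitKernel_zero, abs_zero, zero_add]
  calc ∑ x : (ZMod p)ˣ, |unitKernel p x u|
      ≤ ∑ x : (ZMod p)ˣ, ((if x = u then 1 else 0) + 1 / ((p : ℝ) - 1)) := by
        refine sum_le_sum fun x _ => ?_
        rw [unitKernel_coe]
        refine (abs_sub _ _).trans (le_of_eq ?_)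
        rw [abs_of_nonneg (by positivity : (0 : ℝ) ≤ 1 / ((p : ℝ) - 1)), abs_of_nonneg]
        positivity
    _ = 2 := by
        simp only [sum_add_distrib, sum_ite_eq', mem_univ, if_true, sum_const, card_univ,
          nsmul_eq_mul, card_units_cast]
        field_simp; norm_num

lemma abs_unitKernel_le (x : ZMod p) (u : (ZMod p)ˣ) : |unitKernel p x u| ≤ 1 := by
  have hp : (1 : ℝ) ≤ (p : ℝ) - 1 := by
    have : (2 : ℝ) ≤ p := by exact_mod_cast (Fact.out : p.Prime).two_le
    linarith
  have h1 : 1 / ((p : ℝ) - 1) ≤ 1 := by rw [div_le_one (by linarith)]; exact hp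
  have h0 : 0 ≤ 1 / ((p : ℝ) - 1) := by positivity
  unfold unitKernel
  rw [abs_le]
  split_ifs <;> constructor <;> linarith

lemma sum_norm_sub_mean_sq_le {U : Type*} [Fintype U] (g : U → ℂ) :
    ∑ u, ‖g u - (Fintype.card U : ℂ)⁻¹ * ∑ v, g v‖ ^ 2 ≤ ∑ u, ‖g u‖ ^ 2 := by
  rcases isEmpty_or_nonempty U with h | h
  · simp
  have hc : (Fintype.card U : ℂ) ≠ 0 := by exact_mod_cast Fintype.card_ne_zero
  set S := ∑ v, g v with hS
  have : ((∑ u, ‖g u - (Fintype.card U : ℂ)⁻¹ * S‖ ^ 2 : ℝ) : ℂ) =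
      ((∑ u, ‖g u‖ ^ 2 - (Fintype.card U : ℝ)⁻¹ * ‖S‖ ^ 2 : ℝ) : ℂ) := by
    push_cast
    simp_rw [← Complex.mul_conj', map_sub, map_mul, map_inv₀, Complex.conj_natCast, sub_mul,
      mul_sub, sum_sub_distrib]
    rw [← sum_mul, ← mul_sum, ← map_sum, ← hS]
    simp only [sum_const, card_univ, nsmul_eq_mul]
    field_simp
    ring
  have := Complex.ofReal_injective this
  rw [this]
  have : 0 ≤ (Fintype.card U : ℝ)⁻¹ * ‖S‖ ^ 2 := by positivity
  linarith

lemma stdAddChar_conj (x : ZMod p) :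
    (starRingEnd ℂ) (ZMod.stdAddChar x) = ZMod.stdAddChar (-x) := by
  rw [AddChar.map_neg_eq_conj]

lemma indicator_sub_eq (x y : ZMod p) :
    (if x = y then 1 else 0) - (p : ℂ)⁻¹ =
      (p : ℂ)⁻¹ * ∑ h ∈ univ.erase 0, ZMod.stdAddChar (h * x) * ZMod.stdAddChar (-(h * y)) := by
  classical
  have hp : (p : ℂ) ≠ 0 := by exact_mod_cast (Fact.out : p.Prime).ne_zero
  have h := AddChar.sum_mulShift (x - y) (ZMod.isPrimitive_stdAddChar p)
  rw [← add_sum_erase univ _ (mem_univ 0)] at h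
  simp only [zero_mul, AddChar.map_zero_eq_one, ZMod.card, sub_eq_zero] at h
  have e : ∑ h ∈ univ.erase (0 : ZMod p), ZMod.stdAddChar (h * x) * ZMod.stdAddChar (-(h * y))
      = (if x = y then (p : ℂ) else 0) - 1 := by
    rw [eq_sub_iff_add_eq', show (if x = y then (p : ℂ) else 0) =
      ((if x = y then p else 0 : ℕ) : ℂ) by
      push_cast; rfl, ← h]
    congr 1
    refine sum_congr rfl fun z _ => ?_
    rw [← AddChar.map_add_eq_mul]; congr 1; ring
  rw [e]
  split_ifs
  · field_simp
  · field_simp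
    ring

lemma sum_norm_sq_fourier (c : ZMod p → ℂ) :
    ∑ x, ‖∑ h, c h * ZMod.stdAddChar (-(h * x))‖ ^ 2 = p * ∑ h, ‖c h‖ ^ 2 := by
  apply Complex.ofReal_injective
  push_cast
  simp_rw [← Complex.mul_conj', map_sum, map_mul, stdAddChar_conj, sum_mul_sum]
  rw [sum_comm, mul_sum]
  refine sum_congr rfl fun h _ => ?_
  rw [sum_comm]
  have e (k : ZMod p) : ∑ x, c h * ZMod.stdAddChar (-(h * x)) *
      ((starRingEnd ℂ) (c k) * ZMod.stdAddChar (- -(k * x))) =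
      c h * (starRingEnd ℂ) (c k) * (if k - h = 0 then p else 0 : ℕ) := by
    have h1 := AddChar.sum_mulShift (k - h) (ZMod.isPrimitive_stdAddChar p)
    rw [ZMod.card] at h1
    rw [← h1, mul_sum]
    refine sum_congr rfl fun x _ => ?_
    rw [show x * (k - h) = -(h * x) + - -(k * x) by ring, AddChar.map_add_eq_mul]
    ring
  simp only [e, sub_eq_zero]
  simp [mul_comm]

/-- The variance of a sequence over the unit residue classes modulo `p` is controlled by its
exponential sums at the fractions with denominator `p`. -/
lemma sum_norm_sq_unitKernel_le (s : Finset ℕ) (a : ℕ → ℂ) :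
    ∑ u : (ZMod p)ˣ, ‖∑ m ∈ s, a m * unitKernel p m u‖ ^ 2 ≤
      (p : ℝ)⁻¹ * ∑ h ∈ (univ : Finset (ZMod p)).erase 0,
        ‖∑ m ∈ s, a m * ZMod.stdAddChar (h * (m : ZMod p))‖ ^ 2 := by
  classical
  have hp : (p : ℂ) ≠ 0 := by exact_mod_cast (Fact.out : p.Prime).ne_zero
  have hp' : (p : ℝ) ≠ 0 := by exact_mod_cast (Fact.out : p.Prime).ne_zero
  set g : ZMod p → ℂ := fun x => ∑ m ∈ s, a m * ((if (m : ZMod p) = x then 1 else 0) - (p : ℂ)⁻¹)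
    with hg
  have hcard : (Fintype.card (ZMod p)ˣ : ℂ) = (p : ℂ) - 1 := by
    have := card_units_cast (p := p)
    exact_mod_cast congrArg (fun x : ℝ => (x : ℂ)) this
  have hc0 : (p : ℂ) - 1 ≠ 0 := by rw [← hcard]; exact_mod_cast Fintype.card_ne_zero
  have hT (u : (ZMod p)ˣ) : ∑ m ∈ s, a m * (unitKernel p m u : ℂ) =
      g u - (Fintype.card (ZMod p)ˣ : ℂ)⁻¹ * ∑ v : (ZMod p)ˣ, g v := by
    simp only [hg]
    rw [sum_comm, mul_sum, ← sum_sub_distrib]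
    refine sum_congr rfl fun m _ => ?_
    rw [← mul_sum, ← mul_assoc, mul_comm _ (a m), mul_assoc, ← mul_sub]
    congr 1
    rw [sum_sub_distrib, sum_const, card_univ, nsmul_eq_mul, hcard]
    rcases eq_zero_or_eq_unit (m : ZMod p) with h | ⟨x, h⟩
    · rw [h, unitKernel_zero]
      simp only [fun v : (ZMod p)ˣ => v.ne_zero.symm, if_false, sum_const_zero]
      push_cast
      field_simp; ring
    · rw [h, unitKernel_coe]
      simp only [← Units.ext_iff, sum_ite_eq, mem_univ, if_true, Complex.ofReal_sub, apply_ite,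
        Complex.ofReal_one, Complex.ofReal_zero]
      push_cast
      field_simp; ring
  have hgx (x : ZMod p) : g x = ∑ h, (if h = 0 then 0 else (p : ℂ)⁻¹ *
      ∑ m ∈ s, a m * ZMod.stdAddChar (h * (m : ZMod p))) * ZMod.stdAddChar (-(h * x)) := by
    simp only [hg, indicator_sub_eq]
    rw [← add_sum_erase univ _ (mem_univ 0)]
    simp only [if_true, zero_mul, zero_add, mul_sum]
    rw [sum_comm]
    refine sum_congr rfl fun h hh => ?_
    rw [if_neg (ne_of_mem_erase hh), sum_mul]
    refine sum_congr rfl fun m _ => ?_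
    ring
  calc ∑ u : (ZMod p)ˣ, ‖∑ m ∈ s, a m * unitKernel p m u‖ ^ 2
      ≤ ∑ u : (ZMod p)ˣ, ‖g u‖ ^ 2 := by
        simp_rw [hT]
        exact sum_norm_sub_mean_sq_le fun u : (ZMod p)ˣ => g u
    _ ≤ ∑ x, ‖g x‖ ^ 2 := by
        rw [sum_zmod_eq_sum_units_add (fun x => ‖g x‖ ^ 2)]
        have : 0 ≤ ‖g 0‖ ^ 2 := by positivity
        linarith
    _ = _ := by
        simp_rw [hgx]
        rw [sum_norm_sq_fourier, ← add_sum_erase univ _ (mem_univ 0), if_pos rfl, norm_zero,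
          zero_pow two_ne_zero, zero_add, mul_sum, mul_sum]
        refine sum_congr rfl fun h hh => ?_
        rw [if_neg (ne_of_mem_erase hh), norm_mul, norm_inv, Complex.norm_natCast]
        field_simp

end unitKernel

/-- A family of kernels `K i` on groups of residue classes which are idempotent for multiplicative
convolution, have bounded incomplete sums, and satisfy a large sieve inequality on average. -/
structure IsSieveFamily {ι : Type*} (s : Finset ι) {U : ι → Type*} [∀ i, CommGroup (U i)]
    [∀ i, Fintype (U i)] (K : (i : ι) → ℕ → U i → ℝ) (Δ : ℕ → ℝ) : Prop where
  map_mul : ∀ i ∈ s, ∀ m k c, K i (m * k) c = ∑ u, K i m u * K i k (c * u⁻¹)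
  abs_le_one : ∀ i ∈ s, ∀ m c, |K i m c| ≤ 1
  abs_sum_le : ∀ i ∈ s, ∀ b y c, |∑ k ∈ Ioc 0 y, K i (b * k) c| ≤ 4
  nonneg : ∀ N, 0 ≤ Δ N
  sum_sq_le : ∀ (N : ℕ) (a : ℕ → ℝ),
    ∑ i ∈ s, ∑ u, (∑ m ∈ range N, a m * K i m u) ^ 2 ≤ Δ N * ∑ m ∈ range N, a m ^ 2

lemma indicator_lt_eq_sum_bits (L : ℕ) : ∀ k y : ℕ, y < 2 ^ L →
    (if k < y then (1 : ℝ) else 0) =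
      ∑ j ∈ range L, if Odd (y / 2 ^ j) ∧ k / 2 ^ j + 1 = y / 2 ^ j then 1 else 0 := by
  induction L with
  | zero => intro k y hy; simp at hy; simp [hy]
  | succ L ih =>
    intro k y hy
    rw [sum_range_succ']
    have h := ih (k / 2) (y / 2) (by rw [pow_succ] at hy; omega)
    simp only [Nat.div_div_eq_div_mul, ← pow_succ'] at h
    rw [← h]
    simp only [pow_zero, Nat.div_one, Nat.odd_iff]
    split_ifs <;> first | (exfalso; omega) | norm_num

namespace IsSieveFamily

variable {ι : Type*} {s : Finset ι} {U : ι → Type*} [∀ i, CommGroup (U i)] [∀ i, Fintype (U i)]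
  {K : (i : ι) → ℕ → U i → ℝ} {Δ : ℕ → ℝ}

lemma sum_abs_sum_le (hK : IsSieveFamily s K Δ) (c : (i : ι) → U i) (T : Finset ℕ)
    (a b : ℕ → ℕ → ℝ) (M N : ℕ) :
    ∑ i ∈ s, |∑ t ∈ T, ∑ m ∈ range M, ∑ k ∈ range N, a t m * b t k * K i (m * k) (c i)| ≤
      √(Δ M * Δ N * (∑ t ∈ T, ∑ m ∈ range M, a t m ^ 2) * ∑ t ∈ T, ∑ k ∈ range N, b t k ^ 2) := by
  set A : (i : ι) → ℕ → U i → ℝ := fun i t u => ∑ m ∈ range M, a t m * K i m u with hA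
  set B : (i : ι) → ℕ → U i → ℝ := fun i t u => ∑ k ∈ range N, b t k * K i k (c i * u⁻¹) with hB
  have h1 : ∀ i ∈ s, |∑ t ∈ T, ∑ m ∈ range M, ∑ k ∈ range N, a t m * b t k * K i (m * k) (c i)| ≤
      ∑ x ∈ T ×ˢ (univ : Finset (U i)), |A i x.1 x.2| * |B i x.1 x.2| := by
    intro i hi
    rw [sum_product]
    refine (abs_sum_le_sum_abs _ _).trans (sum_le_sum fun t _ => ?_)
    have e : ∑ m ∈ range M, ∑ k ∈ range N, a t m * b t k * K i (m * k) (c i) =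
        ∑ u, A i t u * B i t u := by
      simp only [hA, hB, sum_mul_sum]
      conv_rhs => rw [sum_comm]
      refine sum_congr rfl fun m _ => ?_
      conv_rhs => rw [sum_comm]
      simp only [hK.map_mul i hi, mul_sum]
      refine sum_congr rfl fun k _ => sum_congr rfl fun u _ => ?_
      ring
    rw [e]
    exact (abs_sum_le_sum_abs _ _).trans (le_of_eq (sum_congr rfl fun u _ => abs_mul _ _))
  have hAs : ∑ i ∈ s, ∑ x ∈ T ×ˢ (univ : Finset (U i)), |A i x.1 x.2| ^ 2 ≤
      Δ M * ∑ t ∈ T, ∑ m ∈ range M, a t m ^ 2 := by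
    simp_rw [sum_product, sq_abs]
    rw [sum_comm, mul_sum]
    exact sum_le_sum fun t _ => hK.sum_sq_le M (a t)
  have hBs : ∑ i ∈ s, ∑ x ∈ T ×ˢ (univ : Finset (U i)), |B i x.1 x.2| ^ 2 ≤
      Δ N * ∑ t ∈ T, ∑ m ∈ range N, b t m ^ 2 := by
    simp_rw [sum_product, sq_abs]
    rw [sum_comm, mul_sum]
    refine sum_le_sum fun t _ => (le_of_eq ?_).trans (hK.sum_sq_le N (b t))
    refine sum_congr rfl fun i _ => ?_
    exact Fintype.sum_equiv ((Equiv.inv (U i)).trans (Equiv.mulLeft (c i))) _ _ fun u => rfl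
  refine (sum_le_sum h1).trans ?_
  rw [sum_sigma']
  refine Real.le_sqrt_of_sq_le ((sum_mul_sq_le_sq_mul_sq _ _ _).trans ?_)
  rw [sum_sigma, sum_sigma]
  refine (mul_le_mul hAs hBs (by positivity) ?_).trans (le_of_eq (by ring))
  have := hK.nonneg M
  positivity

/-- Bilinear sums over a hyperbolic region, averaged over a sieve family. -/
lemma sum_abs_bilinear_le (hK : IsSieveFamily s K Δ) (c : (i : ι) → U i) (a b : ℕ → ℝ)
    (M N L : ℕ) (y : ℕ → ℕ) (hy : ∀ m, y m < 2 ^ L) :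
    ∑ i ∈ s, |∑ m ∈ range M, ∑ k ∈ range N,
        (if k < y m then 1 else 0) * (a m * b k * K i (m * k) (c i))| ≤
      L * √(Δ M * Δ N * (∑ m ∈ range M, a m ^ 2) * ∑ k ∈ range N, b k ^ 2) := by
  set a' : ℕ → ℕ → ℕ → ℝ := fun j t m => if Odd t ∧ y m / 2 ^ j = t then a m else 0 with ha'
  set b' : ℕ → ℕ → ℕ → ℝ := fun j t k => if k / 2 ^ j + 1 = t then b k else 0 with hb'
  have hid (i : ι) : ∑ m ∈ range M, ∑ k ∈ range N,
        (if k < y m then 1 else 0) * (a m * b k * K i (m * k) (c i)) =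
      ∑ j ∈ range L, ∑ t ∈ range (2 ^ L), ∑ m ∈ range M, ∑ k ∈ range N,
        a' j t m * b' j t k * K i (m * k) (c i) := by
    have e (j : ℕ) : ∑ t ∈ range (2 ^ L), ∑ m ∈ range M, ∑ k ∈ range N,
        a' j t m * b' j t k * K i (m * k) (c i) = ∑ m ∈ range M, ∑ k ∈ range N,
        (if Odd (y m / 2 ^ j) ∧ k / 2 ^ j + 1 = y m / 2 ^ j then 1 else 0) *
          (a m * b k * K i (m * k) (c i)) := by
      rw [sum_comm]
      refine sum_congr rfl fun m _ => ?_
      rw [sum_comm]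
      refine sum_congr rfl fun k _ => ?_
      rw [sum_eq_single (y m / 2 ^ j)]
      · simp only [ha', hb', and_true]
        by_cases h1 : Odd (y m / 2 ^ j) <;> by_cases h2 : k / 2 ^ j + 1 = y m / 2 ^ j <;>
          simp [h1, h2]
      · intro t _ ht
        simp [ha', ht.symm]
      · intro h
        exact absurd (mem_range.2 ((Nat.div_le_self _ _).trans_lt (hy m))) h
    simp_rw [e]
    conv_rhs => rw [sum_comm]
    refine sum_congr rfl fun m _ => ?_
    conv_rhs => rw [sum_comm]
    refine sum_congr rfl fun k _ => ?_
    rw [← sum_mul, indicator_lt_eq_sum_bits L k (y m) (hy m)]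
  calc _ ≤ ∑ i ∈ s, ∑ j ∈ range L, |∑ t ∈ range (2 ^ L), ∑ m ∈ range M, ∑ k ∈ range N,
        a' j t m * b' j t k * K i (m * k) (c i)| := by
        refine sum_le_sum fun i _ => ?_
        rw [hid]
        exact abs_sum_le_sum_abs _ _
    _ = ∑ j ∈ range L, ∑ i ∈ s, |∑ t ∈ range (2 ^ L), ∑ m ∈ range M, ∑ k ∈ range N,
        a' j t m * b' j t k * K i (m * k) (c i)| := sum_comm
    _ ≤ ∑ j ∈ range L, √(Δ M * Δ N * (∑ m ∈ range M, a m ^ 2) * ∑ k ∈ range N, b k ^ 2) := by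
        refine sum_le_sum fun j _ =>
          (hK.sum_abs_sum_le c (range (2 ^ L)) (a' j) (b' j) M N).trans ?_
        refine Real.sqrt_le_sqrt ?_
        have hM := hK.nonneg M
        have hN := hK.nonneg N
        have h1 : ∑ t ∈ range (2 ^ L), ∑ m ∈ range M, a' j t m ^ 2 ≤ ∑ m ∈ range M, a m ^ 2 := by
          rw [sum_comm]
          refine sum_le_sum fun m _ => ?_
          rw [sum_eq_single (y m / 2 ^ j)]
          · simp only [ha']
            split_ifs
            · exact le_rfl
            · simp [sq_nonneg]
          · intro t _ ht
            simp [ha', ht.symm]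
          · intro h
            exact absurd (mem_range.2 ((Nat.div_le_self _ _).trans_lt (hy m))) h
        have h2 : ∑ t ∈ range (2 ^ L), ∑ k ∈ range N, b' j t k ^ 2 ≤ ∑ k ∈ range N, b k ^ 2 := by
          rw [sum_comm]
          refine sum_le_sum fun k _ => ?_
          simp only [hb', ite_pow, zero_pow two_ne_zero, sum_ite_eq]
          split_ifs
          · exact le_rfl
          · positivity
        gcongr
    _ = _ := by rw [sum_const, card_range, nsmul_eq_mul]

end IsSieveFamily

namespace ArithmeticFunction

lemma sum_Ioc_mul_mul_eq_sum_sum (f h : ArithmeticFunction ℝ) (g : ℕ → ℝ) (N : ℕ) :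
    ∑ n ∈ Ioc 0 N, (f * h) n * g n =
      ∑ m ∈ Ioc 0 N, f m * ∑ k ∈ Ioc 0 (N / m), h k * g (m * k) := by
  have e : ∑ n ∈ Ioc 0 N, (f * h) n * g n =
      ∑ x ∈ Ioc 0 N ×ˢ Ioc 0 N with x.1 * x.2 ≤ N, f x.1 * h x.2 * g (x.1 * x.2) := by
    simp only [mul_apply, sum_mul]
    trans ∑ n ∈ Ioc 0 N, ∑ x ∈ Ioc 0 N ×ˢ Ioc 0 N with x.1 * x.2 = n,
      f x.1 * h x.2 * g (x.1 * x.2)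
    · refine sum_congr rfl fun n hn ↦ ?_
      simp only [mem_Ioc] at hn
      rw [Nat.divisorsAntidiagonal_eq_prod_filter_of_le hn.1.ne' hn.2]
      refine sum_congr rfl fun x hx => ?_
      rw [(mem_filter.1 hx).2]
    · simp_rw [sum_filter]
      rw [sum_comm]
      exact sum_congr rfl fun _ _ ↦ (by simp_all)
  rw [e, sum_filter, sum_product]
  refine sum_congr rfl fun n hn ↦ ?_
  rw [← sum_filter, mul_sum]
  refine sum_congr ?_ fun k _ => by ring
  ext k
  simp only [mem_filter, mem_Ioc] at hn ⊢
  constructor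
  · rintro ⟨⟨h1, _⟩, h⟩
    exact ⟨h1, (Nat.le_div_iff_mul_le hn.1).2 (by rwa [mul_comm])⟩
  · rintro ⟨h1, h2⟩
    have := (Nat.le_div_iff_mul_le hn.1).1 h2
    exact ⟨⟨h1, h2.trans (Nat.div_le_self _ _)⟩, by rwa [mul_comm]⟩

/-- The restriction of an arithmetic function to `{0, …, W}`, extended by zero. -/
noncomputable def truncate (f : ArithmeticFunction ℝ) (W : ℕ) : ArithmeticFunction ℝ :=
  ⟨fun n => if n ≤ W then f n else 0, by simp⟩

lemma truncate_apply (f : ArithmeticFunction ℝ) (W n : ℕ) :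
    f.truncate W n = if n ≤ W then f n else 0 := rfl

lemma real_sub_apply (f g : ArithmeticFunction ℝ) (n : ℕ) : (f - g) n = f n - g n := by
  rw [sub_eq_add_neg, add_apply]; rfl

/-- Vaughan's identity. -/
lemma vonMangoldt_eq_vaughan (W : ℕ) :
    (vonMangoldt : ArithmeticFunction ℝ) = vonMangoldt.truncate W +
      (moebius : ArithmeticFunction ℝ).truncate W * log -
      (moebius : ArithmeticFunction ℝ).truncate W * vonMangoldt.truncate W * zeta +
      ((moebius : ArithmeticFunction ℝ) - (moebius : ArithmeticFunction ℝ).truncate W) *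
        ((vonMangoldt - vonMangoldt.truncate W) * zeta) := by
  have h1 : ((moebius : ArithmeticFunction ℝ)) * (zeta : ArithmeticFunction ℝ) = 1 :=
    coe_moebius_mul_coe_zeta
  have h2 := vonMangoldt_mul_zeta
  linear_combination (-vonMangoldt + vonMangoldt.truncate W) * h1 +
    (moebius : ArithmeticFunction ℝ).truncate W * h2

lemma abs_moebius_le_one_real (n : ℕ) : |(moebius : ArithmeticFunction ℝ) n| ≤ 1 := by
  rw [intCoe_apply]
  exact_mod_cast abs_moebius_le_one

lemma abs_truncate_moebius_le (W n : ℕ) :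
    |(moebius : ArithmeticFunction ℝ).truncate W n| ≤ if n ≤ W then 1 else 0 := by
  rw [truncate_apply]
  split_ifs
  · exact abs_moebius_le_one_real n
  · simp

lemma truncate_vonMangoldt_mem (W n : ℕ) :
    0 ≤ vonMangoldt.truncate W n ∧ vonMangoldt.truncate W n ≤ vonMangoldt n := by
  rw [truncate_apply]
  split_ifs
  · exact ⟨vonMangoldt_nonneg, le_rfl⟩
  · exact ⟨le_rfl, vonMangoldt_nonneg⟩

lemma abs_truncate_mul_truncate_le (W n : ℕ) :
    |((moebius : ArithmeticFunction ℝ).truncate W * vonMangoldt.truncate W) n| ≤ Real.log n := by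
  rw [mul_apply, ← vonMangoldt_sum, Nat.sum_divisorsAntidiagonal' (fun a b =>
    (moebius : ArithmeticFunction ℝ).truncate W a * vonMangoldt.truncate W b)]
  refine (abs_sum_le_sum_abs _ _).trans (sum_le_sum fun d _ => ?_)
  obtain ⟨h1, h2⟩ := truncate_vonMangoldt_mem W d
  rw [abs_mul, abs_of_nonneg h1]
  have h3 := abs_truncate_moebius_le W (n / d)
  have h4 : |(moebius : ArithmeticFunction ℝ).truncate W (n / d)| ≤ 1 := by
    refine h3.trans ?_
    split_ifs <;> norm_num
  nlinarith

lemma truncate_mul_truncate_eq_zero (f h : ArithmeticFunction ℝ) {W n : ℕ} (hn : W ^ 2 < n) :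
    (f.truncate W * h.truncate W) n = 0 := by
  rw [mul_apply]
  refine sum_eq_zero fun x hx => ?_
  have := (Nat.mem_divisorsAntidiagonal.1 hx).1
  simp only [truncate_apply]
  by_cases h1 : x.1 ≤ W
  · by_cases h2 : x.2 ≤ W
    · nlinarith [Nat.mul_le_mul h1 h2]
    · simp [h2]
  · simp [h1]

lemma vonMangoldt_sub_truncate_mul_zeta_mem (W n : ℕ) :
    0 ≤ ((vonMangoldt - vonMangoldt.truncate W) * zeta) n ∧
      ((vonMangoldt - vonMangoldt.truncate W) * zeta) n ≤ Real.log n := by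
  rw [coe_mul_zeta_apply, ← vonMangoldt_sum]
  have h (d : ℕ) := truncate_vonMangoldt_mem W d
  refine ⟨sum_nonneg fun d _ => ?_, sum_le_sum fun d _ => ?_⟩
  · rw [real_sub_apply]; linarith [(h d).2]
  · rw [real_sub_apply]; linarith [(h d).1]

lemma vonMangoldt_sub_truncate_mul_zeta_eq_zero {W n : ℕ} (hn : n ≤ W) :
    ((vonMangoldt - vonMangoldt.truncate W) * zeta) n = 0 := by
  rw [coe_mul_zeta_apply]
  refine sum_eq_zero fun d hd => ?_
  have := Nat.divisor_le hd
  rw [real_sub_apply, truncate_apply, if_pos (this.trans hn), sub_self]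

end ArithmeticFunction

lemma abs_sum_log_mul_le {a : ℕ → ℝ} {B : ℝ} (h : ∀ y, |∑ k ∈ Ioc 0 y, a k| ≤ B) (Y : ℕ) :
    |∑ k ∈ Ioc 0 Y, Real.log k * a k| ≤ 2 * B * Real.log Y := by
  have key : |∑ k ∈ Ioc 0 Y, Real.log k * a k - Real.log Y * ∑ k ∈ Ioc 0 Y, a k| ≤
      B * Real.log Y := by
    induction Y with
    | zero => simp
    | succ Y ih =>
      rw [sum_Ioc_succ_top (Nat.zero_le _), sum_Ioc_succ_top (Nat.zero_le _)]
      have hmono : Real.log Y ≤ Real.log (Y + 1 : ℕ) := by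
        rcases Nat.eq_zero_or_pos Y with rfl | hY
        · simp
        · exact Real.log_le_log (by exact_mod_cast hY) (by push_cast; linarith)
      have e : ∑ k ∈ Ioc 0 Y, Real.log k * a k + Real.log (Y + 1 : ℕ) * a (Y + 1) -
          Real.log (Y + 1 : ℕ) * (∑ k ∈ Ioc 0 Y, a k + a (Y + 1)) =
          (∑ k ∈ Ioc 0 Y, Real.log k * a k - Real.log Y * ∑ k ∈ Ioc 0 Y, a k) -
          (Real.log (Y + 1 : ℕ) - Real.log Y) * ∑ k ∈ Ioc 0 Y, a k := by ring
      rw [e]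
      refine (abs_sub _ _).trans ?_
      rw [abs_mul, abs_of_nonneg (sub_nonneg.2 hmono)]
      nlinarith [h Y]
  have h0 : 0 ≤ Real.log Y := Real.log_natCast_nonneg Y
  have h1 : |Real.log Y * ∑ k ∈ Ioc 0 Y, a k| ≤ B * Real.log Y := by
    rw [abs_mul, abs_of_nonneg h0]; nlinarith [h Y]
  have := abs_add_le (∑ k ∈ Ioc 0 Y, Real.log k * a k - Real.log Y * ∑ k ∈ Ioc 0 Y, a k)
    (Real.log Y * ∑ k ∈ Ioc 0 Y, a k)
  rw [sub_add_cancel] at this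
  linarith

section

open ArithmeticFunction

lemma abs_sum_vonMangoldt_mul_le (g : ℕ → ℝ) (hg1 : ∀ n, |g n| ≤ 1)
    (hg : ∀ b y, |∑ k ∈ Ioc 0 y, g (b * k)| ≤ 4) {W : ℕ} (hW : 1 ≤ W) (X : ℕ) :
    |∑ r ∈ Ioc 0 X, vonMangoldt r * g r| ≤ 13 * W ^ 2 * Real.log X +
      |∑ m ∈ Ioc 0 X, ((moebius : ArithmeticFunction ℝ) -
        (moebius : ArithmeticFunction ℝ).truncate W) m * ∑ k ∈ Ioc 0 (X / m),
          ((vonMangoldt - vonMangoldt.truncate W) * zeta) k * g (m * k)| := by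
  have hX : 0 ≤ Real.log X := Real.log_natCast_nonneg X
  have hlog {m : ℕ} (h0 : 0 < m) (h : m ≤ X) : Real.log m ≤ Real.log X :=
    Real.log_le_log (by exact_mod_cast h0) (by exact_mod_cast h)
  have hW' : (1 : ℝ) ≤ W := by exact_mod_cast hW
  have hcard (V : ℕ) : ((filter (· ≤ V) (Ioc 0 X)).card : ℝ) ≤ V := by
    have : (filter (· ≤ V) (Ioc 0 X)).card ≤ (Ioc 0 V).card := by
      refine card_le_card fun x hx => ?_
      simp only [mem_filter, mem_Ioc] at hx ⊢
      exact ⟨hx.1.1, hx.2⟩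
    rw [Nat.card_Ioc] at this
    exact_mod_cast this
  have key (V : ℕ) (F : ℕ → ℝ) (B : ℝ) (hB : 0 ≤ B) (h1 : ∀ m ∈ Ioc 0 X, |F m| ≤ B)
      (h2 : ∀ m ∈ Ioc 0 X, V < m → F m = 0) : |∑ m ∈ Ioc 0 X, F m| ≤ V * B := by
    rw [← sum_filter_add_sum_filter_not _ (· ≤ V), sum_eq_zero (s := filter (¬ · ≤ V) _), add_zero]
    · refine (abs_sum_le_sum_abs _ _).trans ((sum_le_card_nsmul _ _ B fun m hm =>
        h1 m (mem_filter.1 hm).1).trans ?_)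
      rw [nsmul_eq_mul]
      exact mul_le_mul_of_nonneg_right (hcard V) hB
    · intro m hm
      rw [mem_filter, not_le] at hm
      exact h2 m hm.1 hm.2
  have t1 : |∑ r ∈ Ioc 0 X, vonMangoldt.truncate W r * g r| ≤ W * Real.log X := by
    refine key W _ _ hX (fun m hm => ?_) (fun m _ h => ?_)
    · have hm := mem_Ioc.1 hm
      obtain ⟨h1, h2⟩ := truncate_vonMangoldt_mem W m
      rw [abs_mul, abs_of_nonneg h1]
      have := hlog hm.1 hm.2
      have h3 : vonMangoldt m ≤ Real.log m := vonMangoldt_le_log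
      nlinarith [hg1 m, abs_nonneg (g m)]
    · rw [truncate_apply, if_neg (not_le.2 h), zero_mul]
  have t2 : |∑ r ∈ Ioc 0 X, ((moebius : ArithmeticFunction ℝ).truncate W * log) r * g r| ≤
      W * (8 * Real.log X) := by
    rw [sum_Ioc_mul_mul_eq_sum_sum]
    refine key W _ _ (by positivity) (fun m hm => ?_) (fun m _ h => ?_)
    · have hm := mem_Ioc.1 hm
      have h1 := abs_truncate_moebius_le W m
      have h2 : |(moebius : ArithmeticFunction ℝ).truncate W m| ≤ 1 := by
        refine h1.trans ?_
        split_ifs <;> norm_num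
      have h3 := abs_sum_log_mul_le (hg m) (X / m)
      have h4 : Real.log ((X / m : ℕ) : ℝ) ≤ Real.log X := by
        rcases Nat.eq_zero_or_pos (X / m) with h | h
        · simp [h, hX]
        · exact hlog h (Nat.div_le_self _ _)
      rw [abs_mul]
      simp only [log_apply]
      nlinarith [abs_nonneg ((moebius : ArithmeticFunction ℝ).truncate W m),
        abs_nonneg (∑ k ∈ Ioc 0 (X / m), Real.log k * g (m * k))]
    · rw [truncate_apply, if_neg (not_le.2 h), zero_mul]
  have t3 : |∑ r ∈ Ioc 0 X, ((moebius : ArithmeticFunction ℝ).truncate W *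
      vonMangoldt.truncate W * zeta) r * g r| ≤ (W ^ 2 : ℕ) * (4 * Real.log X) := by
    rw [sum_Ioc_mul_mul_eq_sum_sum]
    refine key (W ^ 2) _ _ (by positivity) (fun m hm => ?_) (fun m _ h => ?_)
    · have hm' := mem_Ioc.1 hm
      have h1 := (abs_truncate_mul_truncate_le W m).trans (hlog hm'.1 hm'.2)
      have h2 : ∑ k ∈ Ioc 0 (X / m), (zeta : ArithmeticFunction ℝ) k * g (m * k) =
          ∑ k ∈ Ioc 0 (X / m), g (m * k) := by
        refine sum_congr rfl fun k hk => ?_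
        rw [natCoe_apply, zeta_apply, if_neg (mem_Ioc.1 hk).1.ne', Nat.cast_one, one_mul]
      rw [h2, abs_mul]
      have h3 := hg m (X / m)
      nlinarith [abs_nonneg (((moebius : ArithmeticFunction ℝ).truncate W *
        vonMangoldt.truncate W) m), abs_nonneg (∑ k ∈ Ioc 0 (X / m), g (m * k))]
    · rw [truncate_mul_truncate_eq_zero _ _ h, zero_mul]
  have e : ∑ r ∈ Ioc 0 X, vonMangoldt r * g r =
      ∑ r ∈ Ioc 0 X, vonMangoldt.truncate W r * g r +
      ∑ r ∈ Ioc 0 X, ((moebius : ArithmeticFunction ℝ).truncate W * log) r * g r -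
      ∑ r ∈ Ioc 0 X, ((moebius : ArithmeticFunction ℝ).truncate W *
        vonMangoldt.truncate W * zeta) r * g r +
      ∑ r ∈ Ioc 0 X, (((moebius : ArithmeticFunction ℝ) -
        (moebius : ArithmeticFunction ℝ).truncate W) *
          ((vonMangoldt - vonMangoldt.truncate W) * zeta)) r * g r := by
    rw [← sum_add_distrib, ← sum_sub_distrib, ← sum_add_distrib]
    refine sum_congr rfl fun r _ => ?_
    conv_lhs => rw [vonMangoldt_eq_vaughan W]
    rw [ArithmeticFunction.add_apply, real_sub_apply, ArithmeticFunction.add_apply]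
    ring
  rw [e, ← sum_Ioc_mul_mul_eq_sum_sum]
  refine (abs_add_le _ _).trans (add_le_add_left ?_ _)
  refine (abs_sub _ _).trans ((add_le_add_left (abs_add_le _ _) _).trans ?_)
  push_cast at t3
  have : W * Real.log X ≤ W ^ 2 * Real.log X := by
    refine mul_le_mul_of_nonneg_right ?_ hX
    nlinarith
  linarith

end

lemma sieve_factor_mul_le {M N X W Q : ℝ} (hM : 0 ≤ M) (hN : 0 ≤ N) (hQ : 0 < Q)
    (hX : 0 ≤ X) (h1 : M * N ≤ 4 * X) (h2 : M ≤ 2 * X / W) (h3 : N ≤ 4 * X / W) :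
    (M / Q + Q ^ 2) * (N / Q + Q ^ 2) * (M * N) ≤
      16 * X ^ 2 / Q ^ 2 + 24 * X ^ 2 * Q / W + 4 * X * Q ^ 4 := by
  have e : (M / Q + Q ^ 2) * (N / Q + Q ^ 2) * (M * N) =
      (M * N) ^ 2 / Q ^ 2 + Q * ((M * N) * (M + N)) + Q ^ 4 * (M * N) := by
    field_simp
    ring
  have hMN : 0 ≤ M * N := by positivity
  have a1 : (M * N) ^ 2 / Q ^ 2 ≤ 16 * X ^ 2 / Q ^ 2 := by
    gcongr
    nlinarith
  have a2 : Q * ((M * N) * (M + N)) ≤ Q * ((4 * X) * (2 * X / W + 4 * X / W)) := by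
    gcongr
  have a3 : Q ^ 4 * (M * N) ≤ Q ^ 4 * (4 * X) := by gcongr
  rw [e]
  calc _ ≤ 16 * X ^ 2 / Q ^ 2 + Q * ((4 * X) * (2 * X / W + 4 * X / W)) + Q ^ 4 * (4 * X) := by
        linarith
    _ = _ := by ring

namespace IsSieveFamily

variable {ι : Type*} {s : Finset ι} {U : ι → Type*} [∀ i, CommGroup (U i)] [∀ i, Fintype (U i)]
  {K : (i : ι) → ℕ → U i → ℝ} {Q D : ℝ}

lemma sum_abs_dyadic_le (hQ : 0 < Q) (hD : 0 ≤ D)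
    (hK : IsSieveFamily s K fun N => D * (N / Q + Q ^ 2)) (c : (i : ι) → U i)
    {X W L : ℕ} (hW : 1 ≤ W) (hL : X + 1 < 2 ^ L) (a b : ℕ → ℝ) {B : ℝ} (hB : 0 ≤ B)
    (ha : ∀ m, |a m| ≤ 1) (ha0 : ∀ m ≤ W, a m = 0) (hb : ∀ k ≤ X, |b k| ≤ B)
    (hb0 : ∀ k ≤ W, b k = 0) (j : ℕ) :
    ∑ i ∈ s, |∑ m ∈ range (2 ^ (j + 1)), ∑ k ∈ range (X / 2 ^ j + 1),
        (if k < X / m + 1 then 1 else 0) * (a m * b k * K i (m * k) (c i))| ≤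
      L * (D * B * √(16 * X ^ 2 / Q ^ 2 + 24 * X ^ 2 * Q / W + 4 * X * Q ^ 4)) := by
  have hR : 0 ≤ L * (D * B * √(16 * X ^ 2 / Q ^ 2 + 24 * X ^ 2 * Q / W + 4 * X * Q ^ 4)) := by
    positivity
  by_cases h1 : 2 ^ (j + 1) ≤ W
  · rw [sum_eq_zero]
    · exact hR
    · intro i _
      rw [abs_eq_zero]
      refine sum_eq_zero fun m hm => sum_eq_zero fun k _ => ?_
      rw [ha0 m ((mem_range.1 hm).le.trans h1)]
      ring
  by_cases h2 : X / 2 ^ j ≤ W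
  · rw [sum_eq_zero]
    · exact hR
    · intro i _
      rw [abs_eq_zero]
      refine sum_eq_zero fun m hm => sum_eq_zero fun k hk => ?_
      rw [hb0 k ((Nat.lt_succ_iff.1 (mem_range.1 hk)).trans h2)]
      ring
  rw [not_le] at h1 h2
  have hy (m : ℕ) : X / m + 1 < 2 ^ L := (Nat.succ_le_succ (Nat.div_le_self _ _)).trans_lt hL
  refine (hK.sum_abs_bilinear_le c a b _ _ L (fun m => X / m + 1) hy).trans ?_
  refine mul_le_mul_of_nonneg_left ?_ (Nat.cast_nonneg _)
  refine Real.sqrt_le_iff.2 ⟨by positivity, ?_⟩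
  rw [mul_pow, Real.sq_sqrt (by positivity)]
  have hsa : ∑ m ∈ range (2 ^ (j + 1)), a m ^ 2 ≤ (2 ^ (j + 1) : ℕ) := by
    refine (sum_le_card_nsmul _ _ 1 fun m _ => ?_).trans (by simp)
    rw [← sq_abs]
    exact pow_le_one₀ (abs_nonneg _) (ha m)
  have hsb : ∑ k ∈ range (X / 2 ^ j + 1), b k ^ 2 ≤ (X / 2 ^ j + 1 : ℕ) * B ^ 2 := by
    refine (sum_le_card_nsmul _ _ (B ^ 2) fun k hk => ?_).trans (by simp)
    rw [← sq_abs]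
    have hk' := (Nat.lt_succ_iff.1 (mem_range.1 hk)).trans (Nat.div_le_self X (2 ^ j))
    exact pow_le_pow_left₀ (abs_nonneg _) (hb k hk') 2
  set M : ℕ := 2 ^ (j + 1) with hM
  set N : ℕ := X / 2 ^ j + 1 with hN
  set P : ℝ := 2 ^ j with hP
  have hP0 : 0 < P := by positivity
  have hW' : (0 : ℝ) < W := by exact_mod_cast hW
  have hMP : (M : ℝ) = 2 * P := by rw [hM, hP]; push_cast; ring
  have hdiv : ((X / 2 ^ j : ℕ) : ℝ) ≤ X / P := by
    have := Nat.cast_div_le (α := ℝ) (m := X) (n := 2 ^ j)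
    simpa [hP] using this
  have hWX : (W : ℝ) ≤ X / P := le_trans (by exact_mod_cast h2.le) hdiv
  have hWP : (W : ℝ) ≤ 2 * P := by rw [← hMP]; exact_mod_cast h1.le
  have hN1 : (N : ℝ) ≤ 2 * (X / P) := by
    have : (1 : ℝ) ≤ X / P := le_trans (by exact_mod_cast hW) hWX
    rw [hN]; push_cast
    linarith
  have hX0 : (0 : ℝ) ≤ X := Nat.cast_nonneg X
  have b1 : (M : ℝ) * N ≤ 4 * X := by
    calc (M : ℝ) * N ≤ 2 * P * (2 * (X / P)) := by rw [hMP]; gcongr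
      _ = 4 * X := by field_simp; ring
  have b2 : (M : ℝ) ≤ 2 * X / W := by
    rw [le_div_iff₀ hW', hMP]
    rw [le_div_iff₀ hP0] at hWX
    linarith
  have b3 : (N : ℝ) ≤ 4 * X / W := by
    refine hN1.trans ?_
    rw [le_div_iff₀ hW']
    calc 2 * (X / P) * W ≤ 2 * (X / P) * (2 * P) := by gcongr
      _ = 4 * X := by field_simp; ring
  have key := sieve_factor_mul_le (Nat.cast_nonneg M) (Nat.cast_nonneg N) hQ hX0 b1 b2 b3
  calc _ ≤ D * (M / Q + Q ^ 2) * (D * (N / Q + Q ^ 2)) * M * (N * B ^ 2) := by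
        gcongr
    _ = (D * B) ^ 2 * ((M / Q + Q ^ 2) * (N / Q + Q ^ 2) * (M * N)) := by ring
    _ ≤ _ := by gcongr

lemma sum_abs_hyperbola_le (hQ : 0 < Q) (hD : 0 ≤ D)
    (hK : IsSieveFamily s K fun N => D * (N / Q + Q ^ 2)) (c : (i : ι) → U i)
    {X W L : ℕ} (hW : 1 ≤ W) (hL : X + 1 < 2 ^ L) (a b : ℕ → ℝ) {B : ℝ} (hB : 0 ≤ B)
    (ha : ∀ m, |a m| ≤ 1) (ha0 : ∀ m ≤ W, a m = 0) (hb : ∀ k ≤ X, |b k| ≤ B)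
    (hb0 : ∀ k ≤ W, b k = 0) :
    ∑ i ∈ s, |∑ m ∈ Ioc 0 X, a m * ∑ k ∈ Ioc 0 (X / m), b k * K i (m * k) (c i)| ≤
      L ^ 2 * (D * B * √(16 * X ^ 2 / Q ^ 2 + 24 * X ^ 2 * Q / W + 4 * X * Q ^ 4)) := by
  set a' : ℕ → ℕ → ℝ := fun j m => if Nat.log 2 m = j ∧ m ≤ X then a m else 0 with ha'
  have hid (i : ι) : ∑ m ∈ Ioc 0 X, a m * ∑ k ∈ Ioc 0 (X / m), b k * K i (m * k) (c i) =
      ∑ j ∈ range L, ∑ m ∈ range (2 ^ (j + 1)), ∑ k ∈ range (X / 2 ^ j + 1),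
        (if k < X / m + 1 then 1 else 0) * (a' j m * b k * K i (m * k) (c i)) := by
    have hmaps : ∀ m ∈ Ioc 0 X, Nat.log 2 m ∈ range L := by
      intro m hm
      have := mem_Ioc.1 hm
      exact mem_range.2 (Nat.log_lt_of_lt_pow this.1.ne' (by omega))
    rw [← sum_fiberwise_of_maps_to hmaps]
    refine sum_congr rfl fun j _ => ?_
    have e : ∀ m ∈ range (2 ^ (j + 1)), ∑ k ∈ range (X / 2 ^ j + 1),
        (if k < X / m + 1 then 1 else 0) * (a' j m * b k * K i (m * k) (c i)) =
        if m ∈ filter (fun m => Nat.log 2 m = j) (Ioc 0 X) then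
          a m * ∑ k ∈ Ioc 0 (X / m), b k * K i (m * k) (c i) else 0 := by
      intro m _
      split_ifs with h
      · simp only [mem_filter, mem_Ioc] at h
        have hle : X / m ≤ X / 2 ^ j :=
          Nat.div_le_div_left (h.2 ▸ Nat.pow_log_le_self 2 h.1.1.ne') (by positivity)
        simp only [ha', h.2, h.1.2, and_self, if_true, ite_mul, one_mul, zero_mul]
        rw [← sum_filter, mul_sum]
        refine (sum_subset_zero_on_sdiff ?_ ?_ fun k _ => by ring).symm
        · intro k hk
          simp only [mem_filter, mem_range, mem_Ioc] at hk ⊢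
          omega
        · intro k hk
          simp only [mem_sdiff, mem_filter, mem_range, mem_Ioc, not_and, not_le] at hk
          have : k = 0 := by
            by_contra h0
            have := hk.2 (Nat.pos_of_ne_zero h0)
            omega
          rw [this, hb0 0 (Nat.zero_le _)]
          ring
      · refine sum_eq_zero fun k _ => ?_
        have : a' j m = 0 := by
          simp only [ha']
          split_ifs with h'
          · refine ha0 m ?_
            simp only [mem_filter, mem_Ioc, not_and] at h
            by_contra h0
            exact h ⟨by omega, h'.2⟩ h'.1
          · rfl
        rw [this]; ring
    rw [sum_congr rfl e, sum_ite_mem]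
    refine sum_congr ?_ fun _ _ => rfl
    ext m
    simp only [mem_filter, mem_Ioc, mem_inter, mem_range]
    constructor
    · rintro ⟨h1, h2⟩
      exact ⟨h2 ▸ Nat.lt_pow_succ_log_self (by norm_num) m, h1, h2⟩
    · exact fun h => h.2
  calc _ ≤ ∑ i ∈ s, ∑ j ∈ range L, |∑ m ∈ range (2 ^ (j + 1)), ∑ k ∈ range (X / 2 ^ j + 1),
        (if k < X / m + 1 then 1 else 0) * (a' j m * b k * K i (m * k) (c i))| := by
        refine sum_le_sum fun i _ => ?_
        rw [hid]
        exact abs_sum_le_sum_abs _ _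
    _ = ∑ j ∈ range L, ∑ i ∈ s, |∑ m ∈ range (2 ^ (j + 1)), ∑ k ∈ range (X / 2 ^ j + 1),
        (if k < X / m + 1 then 1 else 0) * (a' j m * b k * K i (m * k) (c i))| := sum_comm
    _ ≤ ∑ j ∈ range L,
        L * (D * B * √(16 * X ^ 2 / Q ^ 2 + 24 * X ^ 2 * Q / W + 4 * X * Q ^ 4)) := by
        refine sum_le_sum fun j _ => sum_abs_dyadic_le hQ hD hK c hW hL (a' j) b hB ?_ ?_ hb hb0 j
        · intro m
          simp only [ha']
          split_ifs
          · exact ha m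
          · simp
        · intro m hm
          simp only [ha', ha0 m hm, ite_self]
    _ = _ := by rw [sum_const, card_range, nsmul_eq_mul]; ring

open ArithmeticFunction in
theorem sum_abs_sum_vonMangoldt_le (hQ : 0 < Q) (hD : 0 ≤ D)
    (hK : IsSieveFamily s K fun N => D * (N / Q + Q ^ 2)) (c : (i : ι) → U i)
    {X W L : ℕ} (hW : 1 ≤ W) (hL : X + 1 < 2 ^ L) :
    ∑ i ∈ s, |∑ r ∈ Ioc 0 X, vonMangoldt r * K i r (c i)| ≤
      s.card * (13 * W ^ 2 * Real.log X) +
      L ^ 2 * (D * Real.log X * √(16 * X ^ 2 / Q ^ 2 + 24 * X ^ 2 * Q / W + 4 * X * Q ^ 4)) := by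
  have hX : 0 ≤ Real.log X := Real.log_natCast_nonneg X
  refine (sum_le_sum fun i hi => abs_sum_vonMangoldt_mul_le (fun r => K i r (c i))
    (fun n => hK.abs_le_one i hi n _) (fun b y => hK.abs_sum_le i hi b y _) hW X).trans ?_
  rw [sum_add_distrib, sum_const, nsmul_eq_mul]
  refine add_le_add_right (sum_abs_hyperbola_le hQ hD hK c hW hL _ _ hX ?_ ?_ ?_ ?_) _
  · intro m
    rw [real_sub_apply, truncate_apply]
    split_ifs
    · simp
    · rw [sub_zero]; exact abs_moebius_le_one_real m
  · intro m hm
    rw [real_sub_apply, truncate_apply, if_pos hm, sub_self]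
  · intro k hk
    obtain ⟨h1, h2⟩ := vonMangoldt_sub_truncate_mul_zeta_mem W k
    rw [abs_of_nonneg h1]
    refine h2.trans ?_
    rcases Nat.eq_zero_or_pos k with rfl | h0
    · simpa using hX
    · exact Real.log_le_log (by exact_mod_cast h0) (by exact_mod_cast hk)
  · exact fun k hk => vonMangoldt_sub_truncate_mul_zeta_eq_zero hk

end IsSieveFamily

lemma sum_range_natCast_zmod {d : ℕ} [NeZero d] (g : ZMod d → ℝ) :
    ∑ k ∈ range d, g k = ∑ x, g x := by
  refine sum_bij' (fun k _ => (k : ZMod d)) (fun x _ => x.val) ?_ ?_ ?_ ?_ ?_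
  · exact fun _ _ => mem_univ _
  · exact fun x _ => mem_range.2 x.val_lt
  · exact fun k hk => ZMod.val_cast_of_lt (mem_range.1 hk)
  · exact fun x _ => ZMod.natCast_zmod_val x
  · exact fun _ _ => rfl

lemma abs_sum_range_natCast_zmod_le {d : ℕ} [NeZero d] (g : ZMod d → ℝ) (h0 : ∑ x, g x = 0)
    (y : ℕ) : |∑ k ∈ range y, g k| ≤ ∑ x, |g x| := by
  induction y using Nat.strong_induction_on with
  | _ y ih =>
    rcases lt_or_ge y d with h | h
    · refine (abs_sum_le_sum_abs _ _).trans ?_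
      rw [← sum_range_natCast_zmod fun x => |g x|]
      exact sum_le_sum_of_subset_of_nonneg (range_subset_range.2 h.le) fun _ _ _ => abs_nonneg _
    · obtain ⟨z, rfl⟩ := Nat.exists_eq_add_of_le h
      rw [sum_range_add, sum_range_natCast_zmod, h0, zero_add]
      simpa using ih z (by have := NeZero.pos d; omega)

lemma sum_Ioc_eq_sum_range_succ {g : ℕ → ℝ} (h : g 0 = 0) (y : ℕ) :
    ∑ k ∈ Ioc 0 y, g k = ∑ k ∈ range (y + 1), g k := by
  rw [sum_range_succ', h, add_zero, range_eq_Ico, sum_Ico_add' g 0 y 1]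
  rfl

lemma abs_sum_unitKernel_mul_le {p : ℕ} [Fact p.Prime] (b y : ℕ) (c : (ZMod p)ˣ) :
    |∑ k ∈ Ioc 0 y, unitKernel p ((b * k : ℕ) : ZMod p) c| ≤ 2 := by
  simp only [Nat.cast_mul]
  rcases eq_zero_or_eq_unit (b : ZMod p) with hb | ⟨u, hu⟩
  · simp [hb, unitKernel_zero]
  · simp only [hu, unitKernel_mul_unit]
    rw [sum_Ioc_eq_sum_range_succ (by simp [unitKernel_zero])]
    exact (abs_sum_range_natCast_zmod_le (fun x => unitKernel p x _) (sum_unitKernel _) _).trans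
      (sum_abs_unitKernel_le _)

lemma abs_sum_unitKernel_mul_unitKernel_mul_le {p q : ℕ} [Fact p.Prime] [Fact q.Prime]
    (hpq : p ≠ q) (b y : ℕ) (c : (ZMod p)ˣ) (d : (ZMod q)ˣ) :
    |∑ k ∈ Ioc 0 y, unitKernel p ((b * k : ℕ) : ZMod p) c * unitKernel q ((b * k : ℕ) : ZMod q) d| ≤
      4 := by
  simp only [Nat.cast_mul]
  rcases eq_zero_or_eq_unit (b : ZMod p) with hb | ⟨u, hu⟩
  · simp [hb, unitKernel_zero]
  rcases eq_zero_or_eq_unit (b : ZMod q) with hb | ⟨v, hv⟩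
  · simp [hb, unitKernel_zero]
  simp only [hu, hv, unitKernel_mul_unit]
  rw [sum_Ioc_eq_sum_range_succ (by simp [unitKernel_zero])]
  have hco : p.Coprime q := (Nat.coprime_primes Fact.out Fact.out).2 hpq
  have : NeZero (p * q) :=
    ⟨mul_ne_zero (Fact.out : p.Prime).ne_zero (Fact.out : q.Prime).ne_zero⟩
  set e := ZMod.chineseRemainder hco
  set F : ZMod p × ZMod q → ℝ := fun x => unitKernel p x.1 (u⁻¹ * c) * unitKernel q x.2 (v⁻¹ * d)
    with hF
  have hk (k : ℕ) : unitKernel p (k : ZMod p) (u⁻¹ * c) * unitKernel q (k : ZMod q) (v⁻¹ * d) =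
      F (e (k : ZMod (p * q))) := by
    rw [map_natCast]; rfl
  simp only [hk]
  have hsum (G : ZMod p × ZMod q → ℝ) : ∑ x, G (e x) = ∑ x, G x := Equiv.sum_comp e.toEquiv G
  have h0 : ∑ x, F (e x) = 0 := by
    rw [hsum, Fintype.sum_prod_type]
    simp only [hF, ← mul_sum, sum_unitKernel, mul_zero, sum_const_zero]
  refine (abs_sum_range_natCast_zmod_le (fun x => F (e x)) h0 _).trans ?_
  rw [hsum fun x => |F x|, Fintype.sum_prod_type]
  simp only [hF, abs_mul]
  rw [← sum_mul_sum]
  nlinarith [sum_abs_unitKernel_le (u⁻¹ * c), sum_abs_unitKernel_le (v⁻¹ * d),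
    sum_nonneg fun x (_ : x ∈ (univ : Finset (ZMod p))) => abs_nonneg (unitKernel p x (u⁻¹ * c)),
    sum_nonneg fun x (_ : x ∈ (univ : Finset (ZMod q))) => abs_nonneg (unitKernel q x (v⁻¹ * d))]

lemma stdAddChar_mul_natCast {p : ℕ} [NeZero p] (h : ZMod p) (m : ℕ) :
    ZMod.stdAddChar (h * (m : ZMod p)) = expTwoPi (m * (h.val / p)) := by
  have e : h * (m : ZMod p) = ((h.val * m : ℤ) : ZMod p) := by
    push_cast
    rw [ZMod.natCast_zmod_val]
  rw [e, ZMod.stdAddChar_coe, expTwoPi]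
  congr 1
  push_cast
  ring

lemma sum_sq_unitKernel_mul_unitKernel_le {p q : ℕ} [Fact p.Prime] [Fact q.Prime] (s : Finset ℕ)
    (a : ℕ → ℝ) :
    ∑ u : (ZMod p)ˣ × (ZMod q)ˣ, (∑ m ∈ s, a m * (unitKernel p m u.1 * unitKernel q m u.2)) ^ 2 ≤
      (p : ℝ)⁻¹ * (q : ℝ)⁻¹ * ∑ h ∈ univ.erase (0 : ZMod p), ∑ k ∈ univ.erase (0 : ZMod q),
        ‖∑ m ∈ s, (a m : ℂ) * expTwoPi (m * (h.val / p + k.val / q))‖ ^ 2 := by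
  have e (u : (ZMod p)ˣ × (ZMod q)ˣ) :
      (∑ m ∈ s, a m * (unitKernel p m u.1 * unitKernel q m u.2)) ^ 2 =
      ‖∑ m ∈ s, ((a m : ℂ) * unitKernel q m u.2) * unitKernel p m u.1‖ ^ 2 := by
    rw [← sq_abs, ← Real.norm_eq_abs, ← Complex.norm_real]
    push_cast
    congr 2
    exact sum_congr rfl fun m _ => by ring
  simp only [e]
  rw [Fintype.sum_prod_type_right]
  calc _ ≤ ∑ v : (ZMod q)ˣ, (p : ℝ)⁻¹ * ∑ h ∈ univ.erase (0 : ZMod p),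
        ‖∑ m ∈ s, ((a m : ℂ) * unitKernel q m v) * ZMod.stdAddChar (h * (m : ZMod p))‖ ^ 2 :=
        sum_le_sum fun v _ => sum_norm_sq_unitKernel_le s _
    _ = (p : ℝ)⁻¹ * ∑ h ∈ univ.erase (0 : ZMod p), ∑ v : (ZMod q)ˣ,
        ‖∑ m ∈ s, ((a m : ℂ) * ZMod.stdAddChar (h * (m : ZMod p))) * unitKernel q m v‖ ^ 2 := by
        rw [← mul_sum, sum_comm]
        simp only [mul_right_comm]
    _ ≤ (p : ℝ)⁻¹ * ∑ h ∈ univ.erase (0 : ZMod p), (q : ℝ)⁻¹ * ∑ k ∈ univ.erase (0 : ZMod q),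
        ‖∑ m ∈ s, ((a m : ℂ) * ZMod.stdAddChar (h * (m : ZMod p))) *
          ZMod.stdAddChar (k * (m : ZMod q))‖ ^ 2 := by
        gcongr with h _
        exact sum_norm_sq_unitKernel_le s _
    _ = _ := by
        rw [← mul_sum, ← mul_assoc]
        simp only [stdAddChar_mul_natCast, mul_add, expTwoPi_add, mul_assoc]

lemma sum_sq_unitKernel_le {p : ℕ} [Fact p.Prime] (s : Finset ℕ) (a : ℕ → ℝ) :
    ∑ u : (ZMod p)ˣ, (∑ m ∈ s, a m * unitKernel p m u) ^ 2 ≤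
      (p : ℝ)⁻¹ * ∑ h ∈ univ.erase (0 : ZMod p),
        ‖∑ m ∈ s, (a m : ℂ) * expTwoPi (m * (h.val / p))‖ ^ 2 := by
  have e (u : (ZMod p)ˣ) : (∑ m ∈ s, a m * unitKernel p m u) ^ 2 =
      ‖∑ m ∈ s, (a m : ℂ) * unitKernel p m u‖ ^ 2 := by
    rw [← sq_abs, ← Real.norm_eq_abs, ← Complex.norm_real]
    push_cast
    rfl
  simp only [e, ← stdAddChar_mul_natCast]
  exact sum_norm_sq_unitKernel_le s _

lemma one_div_le_abs_of_mul_eq_intCast {x d D : ℝ} {z : ℤ} (hd : 0 < d) (hdD : d ≤ D)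
    (h : d * x = z) (hz : z ≠ 0) : 1 / D ≤ |x| := by
  have h1 : (1 : ℝ) ≤ |(z : ℝ)| := by exact_mod_cast Int.one_le_abs hz
  rw [← h, abs_mul, abs_of_pos hd] at h1
  rw [div_le_iff₀ (hd.trans_le hdD)]
  nlinarith [abs_nonneg x]

lemma zmod_natCast_ne_zero_of_prime_of_ne {p q : ℕ} (hp : p.Prime) (hq : q.Prime) (h : p ≠ q) :
    (q : ZMod p) ≠ 0 := by
  rw [Ne, ZMod.natCast_eq_zero_iff, Nat.prime_dvd_prime_iff_eq hp hq]
  exact h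

instance Nat.Primes.factPrime (p : Nat.Primes) : Fact (p : ℕ).Prime := ⟨p.2⟩

lemma one_div_le_abs_fracs_sub {p p' : ℕ} [Fact p.Prime] [Fact p'.Prime] {T : ℕ} (hp : p ≤ T)
    (hp' : p' ≤ T) {h : ZMod p} {h' : ZMod p'} (h0 : h ≠ 0)
    (hne : ∀ e : p = p', h' ≠ e ▸ h) (z : ℤ) :
    1 / ((T ^ 2 : ℕ) : ℝ) ≤ |(h.val / p : ℝ) - h'.val / p' - z| := by
  have hpp : p.Prime := Fact.out
  have hpp' : p'.Prime := Fact.out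
  have hp0 : (0 : ℝ) < p := by exact_mod_cast hpp.pos
  have hp0' : (0 : ℝ) < p' := by exact_mod_cast hpp'.pos
  refine one_div_le_abs_of_mul_eq_intCast (d := p * p')
    (z := h.val * p' - h'.val * p - z * (p * p')) (by positivity) ?_ ?_ ?_
  · push_cast
    rw [sq]
    gcongr
  · push_cast
    field_simp
  · intro hz
    by_cases e : p = p'
    · subst e
      have h1 : (h.val : ℤ) - h'.val - z * p = 0 := by
        have : ((h.val : ℤ) - h'.val - z * p) * p = 0 := by rw [← hz]; ring
        exact (mul_eq_zero.1 this).resolve_right (by exact_mod_cast hpp.ne_zero)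
      have h2 := congrArg (Int.cast : ℤ → ZMod p) h1
      push_cast at h2
      rw [ZMod.natCast_zmod_val, ZMod.natCast_zmod_val, ZMod.natCast_self, mul_zero, sub_zero,
        sub_eq_zero] at h2
      exact hne rfl h2.symm
    · have h2 := congrArg (Int.cast : ℤ → ZMod p) hz
      push_cast at h2
      rw [ZMod.natCast_zmod_val, ZMod.natCast_self] at h2
      simp only [mul_zero, zero_mul, sub_zero, mul_eq_zero] at h2
      exact h2.elim h0 (zmod_natCast_ne_zero_of_prime_of_ne hpp hpp' e)

lemma one_div_le_abs_sum_fracs_sub {p q p' q' : ℕ} [Fact p.Prime] [Fact q.Prime] [Fact p'.Prime]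
    [Fact q'.Prime] {T : ℕ} (hpq : p < q) (hpq' : p' < q') (hp : p ≤ T) (hq : q ≤ T) (hp' : p' ≤ T)
    (hq' : q' ≤ T) {h : ZMod p} {k : ZMod q} {h' : ZMod p'} {k' : ZMod q'} (h0 : h ≠ 0) (k0 : k ≠ 0)
    (hne : ∀ (e : p = p') (e' : q = q'), ¬ (h' = e ▸ h ∧ k' = e' ▸ k)) (z : ℤ) :
    1 / ((T ^ 4 : ℕ) : ℝ) ≤
      |(h.val / p + k.val / q : ℝ) - (h'.val / p' + k'.val / q') - z| := by
  have hpp : p.Prime := Fact.out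
  have hpp' : p'.Prime := Fact.out
  have hqq : q.Prime := Fact.out
  have hqq' : q'.Prime := Fact.out
  have hp0 : (0 : ℝ) < p := by exact_mod_cast hpp.pos
  have hp0' : (0 : ℝ) < p' := by exact_mod_cast hpp'.pos
  have hq0 : (0 : ℝ) < q := by exact_mod_cast hqq.pos
  have hq0' : (0 : ℝ) < q' := by exact_mod_cast hqq'.pos
  refine one_div_le_abs_of_mul_eq_intCast (d := (p * q) * (p' * q'))
    (z := (h.val * q + k.val * p) * (p' * q') - (h'.val * q' + k'.val * p') * (p * q) -
      z * ((p * q) * (p' * q'))) (by positivity) ?_ ?_ ?_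
  · push_cast
    calc (p * q * (p' * q') : ℝ) ≤ (T * T) * (T * T) := by gcongr
      _ = (T : ℝ) ^ 4 := by ring
  · push_cast
    field_simp
  · intro hz
    have d1 : p = p' ∨ p = q' := by
      by_contra! hcon
      have h2 := congrArg (Int.cast : ℤ → ZMod p) hz
      push_cast at h2
      rw [ZMod.natCast_zmod_val, ZMod.natCast_self] at h2
      simp only [mul_zero, zero_mul, sub_zero, mul_eq_zero, add_zero] at h2
      have := zmod_natCast_ne_zero_of_prime_of_ne hpp hpp' hcon.1
      have := zmod_natCast_ne_zero_of_prime_of_ne hpp hqq' hcon.2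
      have := zmod_natCast_ne_zero_of_prime_of_ne hpp hqq hpq.ne
      tauto
    have d2 : q = p' ∨ q = q' := by
      by_contra! hcon
      have h2 := congrArg (Int.cast : ℤ → ZMod q) hz
      push_cast at h2
      rw [ZMod.natCast_zmod_val, ZMod.natCast_self] at h2
      simp only [mul_zero, zero_mul, sub_zero, mul_eq_zero, zero_add] at h2
      have := zmod_natCast_ne_zero_of_prime_of_ne hqq hpp' hcon.1
      have := zmod_natCast_ne_zero_of_prime_of_ne hqq hqq' hcon.2
      have := zmod_natCast_ne_zero_of_prime_of_ne hqq hpp hpq.ne'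
      tauto
    obtain rfl : p = p' := by omega
    obtain rfl : q = q' := by omega
    have h1 : ((h.val : ℤ) * q + k.val * p) - (h'.val * q + k'.val * p) - z * (p * q) = 0 := by
      have : (((h.val : ℤ) * q + k.val * p) - (h'.val * q + k'.val * p) - z * (p * q)) * (p * q) =
        0 := by rw [← hz]; ring
      exact (mul_eq_zero.1 this).resolve_right
        (mul_ne_zero (by exact_mod_cast hpp.ne_zero) (by exact_mod_cast hqq.ne_zero))
    refine hne rfl rfl ⟨?_, ?_⟩
    · have h2 := congrArg (Int.cast : ℤ → ZMod p) h1
      push_cast at h2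
      rw [ZMod.natCast_zmod_val, ZMod.natCast_zmod_val, ZMod.natCast_self] at h2
      have h3 : (h - h') * (q : ZMod p) = 0 := by linear_combination h2
      rw [mul_eq_zero, sub_eq_zero] at h3
      exact (h3.resolve_right (zmod_natCast_ne_zero_of_prime_of_ne hpp hqq hpq.ne)).symm
    · have h2 := congrArg (Int.cast : ℤ → ZMod q) h1
      push_cast at h2
      rw [ZMod.natCast_zmod_val, ZMod.natCast_zmod_val, ZMod.natCast_self] at h2
      have h3 : (k - k') * (p : ZMod q) = 0 := by linear_combination h2
      rw [mul_eq_zero, sub_eq_zero] at h3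
      exact (h3.resolve_right (zmod_natCast_ne_zero_of_prime_of_ne hqq hpp hpq.ne')).symm

/-- The logarithmic loss in the large sieve inequalities for moduli composed of primes in
`(T, 2 * T]`. -/
noncomputable def sieveConst (T : ℕ) : ℝ := 16 * (1 + Real.log (((2 * T) ^ 4 : ℕ) : ℝ))

lemma sieveConst_nonneg (T : ℕ) : 0 ≤ sieveConst T := by
  have := Real.log_natCast_nonneg ((2 * T) ^ 4)
  unfold sieveConst
  positivity

lemma isSieveFamily_unitKernel {T : ℕ} (hT : 0 < T) (s : Finset Nat.Primes)
    (hs : ∀ p ∈ s, T < (p : ℕ) ∧ (p : ℕ) ≤ 2 * T) :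
    IsSieveFamily s (U := fun p => (ZMod p)ˣ) (fun p m u => unitKernel p m u)
      fun N => sieveConst T * (N / T + T ^ 2) where
  map_mul p _ m k c := by
    rw [Nat.cast_mul]
    exact unitKernel_mul _ _ _
  abs_le_one p _ m c := abs_unitKernel_le _ _
  abs_sum_le p _ b y c := (abs_sum_unitKernel_mul_le b y c).trans (by norm_num)
  nonneg N := by
    have := sieveConst_nonneg T
    positivity
  sum_sq_le N a := by
    have hT' : (1 : ℝ) ≤ T := by exact_mod_cast hT
    set S := s.sigma fun p => univ.erase (0 : ZMod p)
    have hls := large_sieve S (fun x => (x.2.val / (x.1 : ℕ) : ℝ)) ((2 * T) ^ 2) (by positivity)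
      (by
        rintro ⟨p, h⟩ hi ⟨p', h'⟩ hj hne z
        simp only [S, mem_sigma, mem_erase, mem_univ, and_true] at hi hj
        refine one_div_le_abs_fracs_sub (hs p hi.1).2 (hs p' hj.1).2 hi.2 (fun e he => hne ?_) z
        obtain rfl := Nat.Primes.coe_nat_injective e
        exact congrArg (Sigma.mk p) he.symm) (fun m => (a m : ℂ)) N
    simp only [Complex.norm_real, Real.norm_eq_abs, sq_abs] at hls
    calc _ ≤ ∑ p ∈ s, (T : ℝ)⁻¹ * ∑ h ∈ univ.erase (0 : ZMod p),
          ‖∑ m ∈ range N, (a m : ℂ) * expTwoPi (m * (h.val / (p : ℕ)))‖ ^ 2 := by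
          refine sum_le_sum fun p hp => (sum_sq_unitKernel_le _ a).trans ?_
          have := (hs p hp).1.le
          gcongr
      _ = (T : ℝ)⁻¹ * ∑ x ∈ S,
          ‖∑ m ∈ range N, (a m : ℂ) * expTwoPi (m * (x.2.val / (x.1 : ℕ)))‖ ^ 2 := by
          rw [← mul_sum, sum_sigma]
      _ ≤ (T : ℝ)⁻¹ * ((2 * N + ((2 * T) ^ 2 : ℕ) * (1 + Real.log ((2 * T) ^ 2 : ℕ))) *
          ∑ m ∈ range N, a m ^ 2) := by gcongr
      _ ≤ _ := by
          rw [← mul_assoc]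
          refine mul_le_mul_of_nonneg_right ?_ (by positivity)
          have hlog : Real.log ((2 * T) ^ 2 : ℕ) ≤ Real.log ((2 * T) ^ 4 : ℕ) :=
            Real.log_le_log (by positivity)
              (by exact_mod_cast Nat.pow_le_pow_right (by omega) (by norm_num))
          have hlog0 := Real.log_natCast_nonneg ((2 * T) ^ 2)
          unfold sieveConst
          set l := Real.log ((2 * T) ^ 2 : ℕ)
          set l' := Real.log ((2 * T) ^ 4 : ℕ)
          have hN : (0 : ℝ) ≤ N / T := by positivity
          have e : (T : ℝ)⁻¹ * (2 * N + ((2 * T) ^ 2 : ℕ) * (1 + l)) =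
              2 * (N / T) + 4 * T * (1 + l) := by
            push_cast
            field_simp
            ring
          rw [e]
          have h1 : 4 * T * (1 + l) ≤ 16 * T ^ 2 * (1 + l') := by
            have : (4 * T : ℝ) ≤ 16 * T ^ 2 := by nlinarith
            gcongr
          nlinarith [mul_nonneg hN (hlog0.trans hlog)]

lemma isSieveFamily_unitKernel_mul_unitKernel {T : ℕ} (hT : 0 < T)
    (s : Finset (Nat.Primes × Nat.Primes))
    (hs : ∀ x ∈ s, T < (x.1 : ℕ) ∧ (x.1 : ℕ) < x.2 ∧ (x.2 : ℕ) ≤ 2 * T) :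
    IsSieveFamily s (U := fun x => (ZMod x.1)ˣ × (ZMod x.2)ˣ)
      (fun x m u => unitKernel x.1 m u.1 * unitKernel x.2 m u.2)
      fun N => sieveConst T * (N / T + T ^ 2) where
  map_mul x _ m k c := by
    rw [Nat.cast_mul, Nat.cast_mul, unitKernel_mul, unitKernel_mul, sum_mul_sum,
      Fintype.sum_prod_type]
    refine sum_congr rfl fun u _ => sum_congr rfl fun v _ => ?_
    simp only [Prod.fst_mul, Prod.snd_mul, Prod.fst_inv, Prod.snd_inv]
    ring
  abs_le_one x _ m c := by
    rw [abs_mul]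
    exact mul_le_one₀ (abs_unitKernel_le _ _) (abs_nonneg _) (abs_unitKernel_le _ _)
  abs_sum_le x hx b y c :=
    abs_sum_unitKernel_mul_unitKernel_mul_le (hs x hx).2.1.ne b y c.1 c.2
  nonneg N := by
    have := sieveConst_nonneg T
    positivity
  sum_sq_le N a := by
    have hT' : (1 : ℝ) ≤ T := by exact_mod_cast hT
    set S := s.sigma fun x => univ.erase (0 : ZMod x.1) ×ˢ univ.erase (0 : ZMod x.2)
    have hls := large_sieve S (fun x => (x.2.1.val / (x.1.1 : ℕ) + x.2.2.val / (x.1.2 : ℕ) : ℝ))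
      ((2 * T) ^ 4) (by positivity)
      (by
        rintro ⟨⟨p, q⟩, h, k⟩ hi ⟨⟨p', q'⟩, h', k'⟩ hj hne z
        simp only [S, mem_sigma, mem_product, mem_erase, mem_univ, and_true] at hi hj
        obtain ⟨_, hi2, hi3⟩ := hs _ hi.1
        obtain ⟨_, hj2, hj3⟩ := hs _ hj.1
        refine one_div_le_abs_sum_fracs_sub hi2 hj2 (hi2.le.trans hi3) hi3 (hj2.le.trans hj3) hj3
          hi.2.1 hi.2.2 (fun e e' he => hne ?_) z
        obtain rfl := Nat.Primes.coe_nat_injective e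
        obtain rfl := Nat.Primes.coe_nat_injective e'
        exact congrArg (Sigma.mk (p, q)) (Prod.ext he.1.symm he.2.symm)) (fun m => (a m : ℂ)) N
    simp only [Complex.norm_real, Real.norm_eq_abs, sq_abs] at hls
    calc _ ≤ ∑ x ∈ s, ((T : ℝ)⁻¹ * (T : ℝ)⁻¹) * ∑ h ∈ univ.erase (0 : ZMod x.1),
          ∑ k ∈ univ.erase (0 : ZMod x.2), ‖∑ m ∈ range N, (a m : ℂ) *
            expTwoPi (m * (h.val / (x.1 : ℕ) + k.val / (x.2 : ℕ)))‖ ^ 2 := by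
          refine sum_le_sum fun x hx => (sum_sq_unitKernel_mul_unitKernel_le _ a).trans ?_
          have h1 := (hs x hx).1.le
          have h2 := h1.trans (hs x hx).2.1.le
          gcongr
      _ = ((T : ℝ)⁻¹ * (T : ℝ)⁻¹) * ∑ x ∈ S, ‖∑ m ∈ range N, (a m : ℂ) *
            expTwoPi (m * (x.2.1.val / (x.1.1 : ℕ) + x.2.2.val / (x.1.2 : ℕ)))‖ ^ 2 := by
          rw [← mul_sum, sum_sigma]
          simp only [sum_product]
      _ ≤ ((T : ℝ)⁻¹ * (T : ℝ)⁻¹) *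
          ((2 * N + ((2 * T) ^ 4 : ℕ) * (1 + Real.log ((2 * T) ^ 4 : ℕ))) *
          ∑ m ∈ range N, a m ^ 2) := by gcongr
      _ ≤ _ := by
          rw [← mul_assoc]
          refine mul_le_mul_of_nonneg_right ?_ (by positivity)
          have hlog0 := Real.log_natCast_nonneg ((2 * T) ^ 4)
          unfold sieveConst
          set l := Real.log ((2 * T) ^ 4 : ℕ)
          have hN : (0 : ℝ) ≤ N / T := by positivity
          have e : ((T : ℝ)⁻¹ * (T : ℝ)⁻¹) * (2 * N + ((2 * T) ^ 4 : ℕ) * (1 + l)) =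
              2 * (N / T) * (T : ℝ)⁻¹ + 16 * T ^ 2 * (1 + l) := by
            push_cast
            field_simp
            ring
          rw [e]
          have h1 : 2 * (N / T) * (T : ℝ)⁻¹ ≤ 2 * (N / T) * 1 := by
            gcongr
            exact inv_le_one_of_one_le₀ hT'
          nlinarith [mul_nonneg hN hlog0]

lemma centralBinom_le_pow_mul_pow {k : ℕ} (hk : 2 < k) :
    k.centralBinom ≤
      (2 * k) ^ (Nat.sqrt (2 * k) + #{p ∈ Ioc k (2 * k) | p.Prime}) * 4 ^ (2 * k / 3) := by
  set P := {p ∈ Ioc k (2 * k) | p.Prime}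
  have hpt : ∀ p ∈ range (2 * k + 1), p ^ k.centralBinom.factorization p ≤
      (if p ∈ Icc 1 (Nat.sqrt (2 * k)) ∪ P then 2 * k else 1) *
        (if p ∈ {p ∈ range (2 * k / 3 + 1) | p.Prime} then p else 1) := by
    intro p hp
    simp only [P, mem_union, mem_Icc, mem_filter, mem_Ioc, mem_range] at hp ⊢
    by_cases hpp : p.Prime
    · have h0 := hpp.pos
      by_cases h1 : p ≤ Nat.sqrt (2 * k) ∨ k < p
      · rw [if_pos]
        · refine (Nat.pow_factorization_choose_le (by omega : 0 < 2 * k)).trans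
            (Nat.le_mul_of_pos_right _ ?_)
          split_ifs <;> omega
        · exact h1.imp (fun h => ⟨h0, h⟩) (fun h => ⟨⟨h, by omega⟩, hpp⟩)
      · rw [not_or, not_le, not_lt] at h1
        by_cases h2 : p < 2 * k / 3 + 1
        · rw [if_neg (by omega), one_mul, if_pos ⟨h2, hpp⟩]
          refine (Nat.pow_le_pow_right h0 ?_).trans (pow_one p).le
          exact Nat.factorization_choose_le_one (Nat.sqrt_lt'.mp h1.1)
        · rw [Nat.factorization_centralBinom_of_two_mul_self_lt_three_mul hk h1.2 (by omega),
            pow_zero]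
          exact Nat.one_le_iff_ne_zero.2 (mul_ne_zero (by split_ifs <;> omega)
            (by split_ifs <;> omega))
    · rw [Nat.factorization_eq_zero_of_not_prime _ hpp, pow_zero]
      simp only [hpp, and_false, if_false, or_false, mul_one]
      split_ifs <;> omega
  rw [← Nat.prod_pow_factorization_centralBinom k]
  refine (prod_le_prod' hpt).trans ?_
  rw [prod_mul_distrib, prod_ite_mem, prod_ite_mem]
  refine mul_le_mul' ?_ ?_
  · rw [prod_const]
    refine Nat.pow_le_pow_right (by omega) ((card_le_card inter_subset_right).trans
      ((card_union_le _ _).trans ?_))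
    rw [Nat.card_Icc, Nat.add_sub_cancel]
  · refine le_trans ?_ (primorial_le_four_pow (2 * k / 3))
    refine prod_le_prod_of_subset_of_one_le' inter_subset_right fun p hp _ => ?_
    exact (mem_filter.1 hp).2.pos

lemma mul_log_four_le_card_primes {k : ℕ} (hk : 4 ≤ k) :
    k * Real.log 4 / 3 ≤
      (√(2 * k) + 1 + #{p ∈ Ioc k (2 * k) | p.Prime}) * Real.log (2 * k) := by
  set A := #{p ∈ Ioc k (2 * k) | p.Prime}
  have h := (Nat.four_pow_lt_mul_centralBinom k hk).le.trans
    (Nat.mul_le_mul_left k (centralBinom_le_pow_mul_pow (by omega : 2 < k)))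
  have hk0 : (0 : ℝ) < k := by exact_mod_cast (by omega : 0 < k)
  have h' : (4 : ℝ) ^ k ≤ k * ((2 * k) ^ (Nat.sqrt (2 * k) + A) * 4 ^ (2 * k / 3)) := by
    exact_mod_cast h
  have h2 := Real.log_le_log (by positivity) h'
  rw [Real.log_mul (by positivity) (by positivity), Real.log_mul (by positivity) (by positivity),
    Real.log_pow, Real.log_pow, Real.log_pow] at h2
  have hlk : Real.log k ≤ Real.log (2 * k) := Real.log_le_log hk0 (by linarith)
  have hlk0 : 0 ≤ Real.log (2 * k) := by
    refine Real.log_nonneg ?_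
    have : (4 : ℝ) ≤ k := by exact_mod_cast hk
    linarith
  have hl4 : 0 ≤ Real.log 4 := Real.log_nonneg (by norm_num)
  have hs : (Nat.sqrt (2 * k) : ℝ) ≤ √(2 * k) := by
    have := Real.nat_sqrt_le_real_sqrt (a := 2 * k)
    push_cast at this
    exact this
  have hd : ((2 * k / 3 : ℕ) : ℝ) ≤ 2 * k / 3 := by
    have := Nat.cast_div_le (α := ℝ) (m := 2 * k) (n := 3)
    push_cast at this
    exact this
  push_cast at h2
  have h3 : ((2 * k / 3 : ℕ) : ℝ) * Real.log 4 ≤ 2 * k / 3 * Real.log 4 := by gcongr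
  have h4 : (Nat.sqrt (2 * k) : ℝ) * Real.log (2 * k) ≤ √(2 * k) * Real.log (2 * k) := by gcongr
  nlinarith

open Filter Asymptotics in
lemma eventually_card_primes_Ioc_ge :
    ∀ᶠ k : ℕ in atTop, (k : ℝ) / 4 ≤ #{p ∈ Ioc k (2 * k) | p.Prime} * Real.log (2 * k) := by
  have h1 : Tendsto (fun k : ℕ => (2 * k : ℝ)) atTop atTop :=
    tendsto_natCast_atTop_atTop.const_mul_atTop (by norm_num)
  have h2 := ((isLittleO_log_rpow_atTop (by norm_num : (0 : ℝ) < 1 / 4)).comp_tendsto h1).bound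
    (by norm_num : (0 : ℝ) < 1 / 32)
  have h3 := h1.eventually_ge_atTop (10 ^ 4)
  filter_upwards [h2, h3, eventually_ge_atTop 4] with k h2 h3 h4
  have h := mul_log_four_le_card_primes h4
  set y : ℝ := 2 * k with hy
  have hy1 : 1 ≤ y := by linarith
  have hl : 0 ≤ Real.log y := Real.log_nonneg hy1
  simp only [Function.comp, Real.norm_eq_abs] at h2
  rw [← hy, abs_of_nonneg hl, abs_of_nonneg (by positivity)] at h2
  have e1 : √y * y ^ (1 / 4 : ℝ) ≤ y := by
    rw [Real.sqrt_eq_rpow, ← Real.rpow_add (by linarith)]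
    calc y ^ (1 / 2 + 1 / 4 : ℝ) ≤ y ^ (1 : ℝ) :=
          Real.rpow_le_rpow_of_exponent_le hy1 (by norm_num)
      _ = y := Real.rpow_one y
  have hs : 1 ≤ √y := Real.one_le_sqrt.2 hy1
  have hlog4 : (1.38 : ℝ) ≤ Real.log 4 := by
    rw [show (4 : ℝ) = 2 ^ 2 by norm_num, Real.log_pow]
    have := Real.log_two_gt_d9
    push_cast
    linarith
  have e2 : (√y + 1) * Real.log y ≤ y / 16 := by
    calc (√y + 1) * Real.log y ≤ (√y + √y) * (1 / 32 * y ^ (1 / 4 : ℝ)) := by gcongr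
      _ = (√y * y ^ (1 / 4 : ℝ)) / 16 := by ring
      _ ≤ y / 16 := by linarith
  have e3 : (k : ℝ) * 1.38 / 3 ≤ k * Real.log 4 / 3 := by gcongr
  have hk : (k : ℝ) = y / 2 := by rw [hy]; ring
  rw [add_mul] at h
  linarith

lemma abs_sum_prime_log_mul_sub_le {K : ℕ → ℝ} (hK : ∀ m, |K m| ≤ 1) {k : ℕ} (hk : 0 < k) :
    |∑ r ∈ Ioc k (2 * k) with r.Prime, Real.log r * K r -
      ∑ r ∈ Ioc k (2 * k), ArithmeticFunction.vonMangoldt r * K r| ≤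
        2 * √(2 * k) * Real.log (2 * k) := by
  have hk' : (1 : ℝ) ≤ 2 * k := by exact_mod_cast (by omega : 1 ≤ 2 * k)
  rw [← sum_filter_add_sum_filter_not (Ioc k (2 * k)) (fun r => r.Prime)
    (fun r => ArithmeticFunction.vonMangoldt r * K r)]
  have e : ∑ r ∈ Ioc k (2 * k) with r.Prime, Real.log r * K r =
      ∑ r ∈ Ioc k (2 * k) with r.Prime, ArithmeticFunction.vonMangoldt r * K r :=
    sum_congr rfl fun r hr => by
      rw [ArithmeticFunction.vonMangoldt_apply_prime (mem_filter.1 hr).2]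
  rw [e, sub_add_cancel_left, abs_neg]
  refine le_trans ?_ (Chebyshev.psi_sub_theta_le hk')
  rw [Chebyshev.psi_sub_theta_eq_sum_not_prime,
    show ⌊(2 * k : ℝ)⌋₊ = 2 * k by exact_mod_cast Nat.floor_natCast (R := ℝ) (2 * k)]
  refine (abs_sum_le_sum_abs _ _).trans ((sum_le_sum fun r _ => ?_).trans
    (sum_le_sum_of_subset_of_nonneg
      (filter_subset_filter _ (Ioc_subset_Ioc_left k.zero_le))
      fun r _ _ => ArithmeticFunction.vonMangoldt_nonneg))
  rw [abs_mul, abs_of_nonneg ArithmeticFunction.vonMangoldt_nonneg]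
  exact mul_le_of_le_one_right ArithmeticFunction.vonMangoldt_nonneg (hK r)

/-- The error term for the average distribution of the primes of `(k, 2 * k]`, for `D` moduli
composed of primes of `(T, 2 * T]`. -/
noncomputable def distributionError (T k W L : ℕ) : ℝ :=
  2 * (T ^ 2 * (13 * W ^ 2 * Real.log (2 * k)) +
    L ^ 2 * (sieveConst T * Real.log (2 * k) * √(16 * (2 * k) ^ 2 / T ^ 2 +
      24 * (2 * k) ^ 2 * T / W + 4 * (2 * k) * T ^ 4))) +
  T ^ 2 * (2 * √(2 * k) * Real.log (2 * k))

lemma IsSieveFamily.sum_abs_sum_prime_le {ι : Type*} {s : Finset ι} {U : ι → Type*}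
    [∀ i, CommGroup (U i)] [∀ i, Fintype (U i)] {K : (i : ι) → ℕ → U i → ℝ} {T : ℕ} (hT : 0 < T)
    (hK : IsSieveFamily s K fun N => sieveConst T * (N / T + T ^ 2)) (c : (i : ι) → U i)
    (hs : #s ≤ T ^ 2) {k W L : ℕ} (hk : 0 < k) (hW : 1 ≤ W) (hL : 2 * k + 1 < 2 ^ L) :
    ∑ i ∈ s, |∑ r ∈ Ioc k (2 * k) with r.Prime, Real.log r * K i r (c i)| ≤
      distributionError T k W L := by
  have hs' : (#s : ℝ) ≤ T ^ 2 := by exact_mod_cast hs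
  have hT' : (0 : ℝ) < T := by exact_mod_cast hT
  have hk' : (0 : ℝ) < k := by exact_mod_cast hk
  have hlog : Real.log k ≤ Real.log (2 * k) := Real.log_le_log hk' (by linarith)
  have hlog0 : 0 ≤ Real.log (2 * k) := (Real.log_natCast_nonneg k).trans hlog
  have hS := sieveConst_nonneg T
  set M : ℝ := T ^ 2 * (13 * W ^ 2 * Real.log (2 * k)) +
    L ^ 2 * (sieveConst T * Real.log (2 * k) * √(16 * (2 * k) ^ 2 / T ^ 2 +
      24 * (2 * k) ^ 2 * T / W + 4 * (2 * k) * T ^ 4)) with hM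
  have h1 := hK.sum_abs_sum_vonMangoldt_le hT' hS c hW (X := k) (L := L) (by omega)
  have h2 := hK.sum_abs_sum_vonMangoldt_le hT' hS c hW (X := 2 * k) hL
  have h1' : ∑ i ∈ s, |∑ r ∈ Ioc 0 k, ArithmeticFunction.vonMangoldt r * K i r (c i)| ≤ M := by
    refine h1.trans ?_
    rw [hM]
    gcongr <;> linarith
  have h2' : ∑ i ∈ s, |∑ r ∈ Ioc 0 (2 * k),
      ArithmeticFunction.vonMangoldt r * K i r (c i)| ≤ M := by
    refine h2.trans ?_
    rw [hM]
    push_cast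
    gcongr
  calc _ ≤ ∑ i ∈ s, (|∑ r ∈ Ioc 0 k, ArithmeticFunction.vonMangoldt r * K i r (c i)| +
        |∑ r ∈ Ioc 0 (2 * k), ArithmeticFunction.vonMangoldt r * K i r (c i)| +
        2 * √(2 * k) * Real.log (2 * k)) := by
        refine sum_le_sum fun i hi => ?_
        have h := abs_sum_prime_log_mul_sub_le (fun m => hK.abs_le_one i hi m (c i)) hk
        have e := sum_Ioc_consecutive
          (fun r => ArithmeticFunction.vonMangoldt r * K i r (c i)) k.zero_le
          (by omega : k ≤ 2 * k)
        rw [← e]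
        rw [abs_le] at h
        rw [abs_le]
        set a := ∑ r ∈ Ioc 0 k, ArithmeticFunction.vonMangoldt r * K i r (c i)
        set b := ∑ r ∈ Ioc k (2 * k), ArithmeticFunction.vonMangoldt r * K i r (c i)
        have ha := le_abs_self a
        have ha' := neg_abs_le a
        have hb := le_abs_self (a + b)
        have hb' := neg_abs_le (a + b)
        constructor <;> linarith
    _ ≤ M + M + T ^ 2 * (2 * √(2 * k) * Real.log (2 * k)) := by
        rw [sum_add_distrib, sum_add_distrib, sum_const, nsmul_eq_mul]
        gcongr
    _ = _ := by rw [distributionError, hM]; ring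

lemma unitKernel_of_ne_zero {p : ℕ} {x : ZMod p} (hx : x ≠ 0) (u : (ZMod p)ˣ) :
    unitKernel p x u = (if x = u then 1 else 0) - 1 / ((p : ℝ) - 1) := by
  rw [unitKernel, if_neg hx]

lemma sum_div_le_of_not_congr {p q : ℕ} [Fact p.Prime] [Fact q.Prime] (u : (ZMod p)ˣ)
    (v : (ZMod q)ˣ) (S : Finset ℕ) (f : ℕ → ℝ)
    (hS : ∀ r ∈ S, (r : ZMod p) ≠ 0 ∧ (r : ZMod q) ≠ 0 ∧ ¬ ((r : ZMod p) = u ∧ (r : ZMod q) = v)) :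
    1 / ((p : ℝ) - 1) * (1 / ((q : ℝ) - 1)) * ∑ r ∈ S, f r ≤
      |∑ r ∈ S, f r * (unitKernel p r u * unitKernel q r v)| +
        1 / ((p : ℝ) - 1) * |∑ r ∈ S, f r * unitKernel q r v| +
        1 / ((q : ℝ) - 1) * |∑ r ∈ S, f r * unitKernel p r u| := by
  have hp := cast_sub_one_pos (p := p)
  have hq := cast_sub_one_pos (p := q)
  set α := 1 / ((p : ℝ) - 1)
  set β := 1 / ((q : ℝ) - 1)
  have hα : 0 ≤ α := by positivity
  have hβ : 0 ≤ β := by positivity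
  have e : α * β * ∑ r ∈ S, f r = -(∑ r ∈ S, f r * (unitKernel p r u * unitKernel q r v)) -
      α * ∑ r ∈ S, f r * unitKernel q r v - β * ∑ r ∈ S, f r * unitKernel p r u := by
    rw [mul_sum, mul_sum, mul_sum, ← sum_neg_distrib, ← sum_sub_distrib, ← sum_sub_distrib]
    refine sum_congr rfl fun r hr => ?_
    obtain ⟨h1, h2, h3⟩ := hS r hr
    rw [unitKernel_of_ne_zero h1, unitKernel_of_ne_zero h2]
    have : (if (r : ZMod p) = u then (1 : ℝ) else 0) * (if (r : ZMod q) = v then 1 else 0) = 0 := by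
      split_ifs <;> simp_all
    linear_combination f r * this
  rw [e]
  set A := ∑ r ∈ S, f r * (unitKernel p r u * unitKernel q r v)
  have hA := neg_abs_le A
  have hB := mul_le_mul_of_nonneg_left (neg_abs_le (∑ r ∈ S, f r * unitKernel q r v)) hα
  have hC := mul_le_mul_of_nonneg_left (neg_abs_le (∑ r ∈ S, f r * unitKernel p r u)) hβ
  linarith

/-- If no prime of `(k, 2 * k]` satisfies any of the pairs of congruences, then the total mass of
these primes is controlled by the error term. -/
lemma card_mul_sum_log_le {T k W L : ℕ} (hT : 0 < T) (hTk : 2 * T ≤ k) (hW : 1 ≤ W)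
    (hL : 2 * k + 1 < 2 ^ L) (s : Finset Nat.Primes)
    (hs : ∀ p ∈ s, T < (p : ℕ) ∧ (p : ℕ) ≤ 2 * T) (u v : (p : Nat.Primes) → (ZMod p)ˣ)
    (h : ∀ p ∈ s, ∀ q ∈ s, (p : ℕ) < q → ∀ r ∈ Ioc k (2 * k), r.Prime →
      ¬ ((r : ZMod p) = u p ∧ (r : ZMod q) = v q)) :
    #{x ∈ s ×ˢ s | (x.1 : ℕ) < x.2} * (∑ r ∈ Ioc k (2 * k) with r.Prime, Real.log r) / (4 * T ^ 2) ≤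
      3 * distributionError T k W L := by
  have hT' : (0 : ℝ) < T := by exact_mod_cast hT
  have hk : 0 < k := by omega
  have hsT : #s ≤ T := by
    calc #s = #(s.map ⟨fun p : Nat.Primes => (p : ℕ), Nat.Primes.coe_nat_injective⟩) :=
          (card_map _).symm
      _ ≤ #(Ioc T (2 * T)) := card_le_card fun x hx => by
          obtain ⟨p, hp, rfl⟩ := mem_map.1 hx
          exact mem_Ioc.2 (hs p hp)
      _ = T := by rw [Nat.card_Ioc]; omega
  set S := {r ∈ Ioc k (2 * k) | r.Prime}
  set s2 := {x ∈ s ×ˢ s | (x.1 : ℕ) < x.2} with hs2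
  have hmem : ∀ x ∈ s2, x.1 ∈ s ∧ x.2 ∈ s ∧ (x.1 : ℕ) < x.2 := fun x hx => by
    simpa [hs2, and_assoc] using hx
  have hsT2 : #s ≤ T ^ 2 := hsT.trans (Nat.le_self_pow two_ne_zero T)
  have hs2T : #s2 ≤ T ^ 2 := by
    refine (card_filter_le _ _).trans ?_
    rw [card_product, sq]
    exact Nat.mul_le_mul hsT hsT
  have b1 := (isSieveFamily_unitKernel hT s hs).sum_abs_sum_prime_le hT u hsT2 hk hW hL
  have b2 := (isSieveFamily_unitKernel hT s hs).sum_abs_sum_prime_le hT v hsT2 hk hW hL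
  have b3 := (isSieveFamily_unitKernel_mul_unitKernel hT s2 fun x hx =>
    ⟨(hs _ (hmem x hx).1).1, (hmem x hx).2.2, (hs _ (hmem x hx).2.1).2⟩).sum_abs_sum_prime_le hT
      (fun x => (u x.1, v x.2)) hs2T hk hW hL
  have hF : 0 ≤ ∑ r ∈ S, Real.log r := sum_nonneg fun r _ => Real.log_natCast_nonneg r
  have hprod (g : Nat.Primes → ℝ) (hg : ∀ p, 0 ≤ g p) :
      ∑ p ∈ s, ∑ q ∈ s, 1 / (T : ℝ) * g q ≤ ∑ q ∈ s, g q := by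
    rw [sum_const, ← mul_sum, nsmul_eq_mul, ← mul_assoc]
    refine mul_le_of_le_one_left (sum_nonneg fun p _ => hg p) ?_
    rw [mul_one_div, div_le_one hT']
    exact_mod_cast hsT
  set P : Nat.Primes → ℝ := fun p => |∑ r ∈ S, Real.log r * unitKernel p r (u p)|
  set Q : Nat.Primes → ℝ := fun q => |∑ r ∈ S, Real.log r * unitKernel q r (v q)|
  have key : ∀ x ∈ s2, (∑ r ∈ S, Real.log r) / (4 * T ^ 2) ≤
      |∑ r ∈ S, Real.log r * (unitKernel x.1 r (u x.1) * unitKernel x.2 r (v x.2))| +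
        1 / (T : ℝ) * Q x.2 + 1 / (T : ℝ) * P x.1 := by
    intro x hx
    obtain ⟨hx1, hx2, hlt⟩ := hmem x hx
    have bound (p : Nat.Primes) (hp : p ∈ s) :
        1 / (2 * T : ℝ) ≤ 1 / ((p : ℝ) - 1) ∧ 1 / ((p : ℝ) - 1) ≤ 1 / (T : ℝ) := by
      obtain ⟨h1, h2⟩ := hs p hp
      have h1' : (T : ℝ) + 1 ≤ (p : ℕ) := by exact_mod_cast h1
      have h2' : ((p : ℕ) : ℝ) ≤ 2 * T := by exact_mod_cast h2
      exact ⟨one_div_le_one_div_of_le (by linarith) (by linarith),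
        one_div_le_one_div_of_le hT' (by linarith)⟩
    have hne (p : Nat.Primes) (hp : p ∈ s) {r : ℕ} (hr : r ∈ S) : (r : ZMod p) ≠ 0 := by
      obtain ⟨hr1, hr2⟩ := mem_filter.1 hr
      rw [Ne, ZMod.natCast_eq_zero_iff, Nat.prime_dvd_prime_iff_eq p.2 hr2]
      have := (hs p hp).2
      have := (mem_Ioc.1 hr1).1
      omega
    have := sum_div_le_of_not_congr (u x.1) (v x.2) S (fun r => Real.log r) fun r hr =>
      ⟨hne _ hx1 hr, hne _ hx2 hr,
        h _ hx1 _ hx2 hlt r (mem_filter.1 hr).1 (mem_filter.1 hr).2⟩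
    calc (∑ r ∈ S, Real.log r) / (4 * T ^ 2) =
          1 / (2 * T : ℝ) * (1 / (2 * T : ℝ)) * ∑ r ∈ S, Real.log r := by field_simp; ring
      _ ≤ _ := by
        refine (mul_le_mul_of_nonneg_right ?_ hF).trans (this.trans ?_)
        · exact mul_le_mul (bound _ hx1).1 (bound _ hx2).1 (by positivity)
            ((by positivity : (0 : ℝ) ≤ 1 / (2 * T)).trans (bound _ hx1).1)
        · exact add_le_add (add_le_add le_rfl
            (mul_le_mul_of_nonneg_right (bound _ hx1).2 (abs_nonneg _)))
            (mul_le_mul_of_nonneg_right (bound _ hx2).2 (abs_nonneg _))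
  have hsum := sum_le_sum key
  rw [sum_const, nsmul_eq_mul, ← mul_div_assoc, sum_add_distrib, sum_add_distrib] at hsum
  have hQ : ∑ x ∈ s2, 1 / (T : ℝ) * Q x.2 ≤ ∑ q ∈ s, Q q := by
    refine (sum_le_sum_of_subset_of_nonneg (filter_subset _ _) fun x _ _ => by
      positivity).trans ?_
    rw [sum_product]
    exact hprod Q fun _ => abs_nonneg _
  have hP : ∑ x ∈ s2, 1 / (T : ℝ) * P x.1 ≤ ∑ p ∈ s, P p := by
    refine (sum_le_sum_of_subset_of_nonneg (filter_subset _ _) fun x _ _ => by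
      positivity).trans ?_
    rw [sum_product_right]
    exact hprod P fun _ => abs_nonneg _
  linarith

open Filter Asymptotics in
lemma eventually_const_mul_log_pow_lt (C : ℝ) (m : ℕ) {a : ℝ} (ha : 0 < a) :
    ∀ᶠ n : ℕ in atTop, C * Real.log n ^ m < (n : ℝ) ^ a := by
  have h := ((isLittleO_log_rpow_rpow_atTop (m : ℝ) ha).comp_tendsto
    (tendsto_natCast_atTop_atTop (R := ℝ))).bound (by positivity : 0 < 1 / (|C| + 1))
  filter_upwards [h, eventually_ge_atTop 1] with n hn h1
  have hl := Real.log_natCast_nonneg n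
  have hpos : (0 : ℝ) < (n : ℝ) ^ a := Real.rpow_pos_of_pos (by exact_mod_cast h1) a
  simp only [Function.comp, Real.rpow_natCast, Real.norm_eq_abs] at hn
  rw [abs_of_nonneg (by positivity), abs_of_pos hpos, one_div_mul_eq_div,
    le_div_iff₀ (by positivity)] at hn
  have h2 : C * Real.log n ^ m ≤ |C| * Real.log n ^ m := by gcongr; exact le_abs_self C
  rcases (pow_nonneg hl m).eq_or_lt with h0 | h0
  · rw [← h0, mul_zero]; exact hpos
  · linarith

lemma card_primeFactors_lt (n : ℕ) : #n.primeFactors < Nat.log 2 n + 1 := by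
  rcases Nat.eq_zero_or_pos n with rfl | h0
  · simp
  rw [Nat.lt_succ_iff]
  refine Nat.le_log_of_pow_le one_lt_two ?_
  calc 2 ^ #n.primeFactors = ∏ p ∈ n.primeFactors, 2 := by rw [prod_const]
    _ ≤ ∏ p ∈ n.primeFactors, p :=
      prod_le_prod' fun p hp => (Nat.prime_of_mem_primeFactors hp).two_le
    _ ≤ n := Nat.le_of_dvd h0 (Nat.prod_primeFactors_dvd n)

lemma natLog_two_add_one_le {n : ℕ} (hn : 1 ≤ Real.log n) :
    ((Nat.log 2 n + 1 : ℕ) : ℝ) ≤ 3 * Real.log n := by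
  have h0 : 0 < n := by
    rcases Nat.eq_zero_or_pos n with rfl | h0
    · simp at hn; linarith
    · exact h0
  have h : ((2 : ℝ)) ^ (Nat.log 2 n) ≤ n := by exact_mod_cast Nat.pow_log_le_self 2 h0.ne'
  have h2 := Real.log_le_log (by positivity) h
  rw [Real.log_pow] at h2
  have := Real.log_two_gt_d9
  have h3 : (Nat.log 2 n : ℝ) * 0.5 ≤ Nat.log 2 n * Real.log 2 := by gcongr; linarith
  push_cast
  linarith

/-- The primes of `(T, 2 * T]` not dividing `n`. -/
def coprimePrimes (T n : ℕ) : Finset Nat.Primes :=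
  ({p ∈ Ioc T (2 * T) | ¬ p ∣ n}).subtype Nat.Prime

lemma mem_coprimePrimes {T n : ℕ} {p : Nat.Primes} :
    p ∈ coprimePrimes T n ↔ (T < (p : ℕ) ∧ (p : ℕ) ≤ 2 * T) ∧ ¬ (p : ℕ) ∣ n := by
  refine Finset.mem_subtype.trans ?_
  rw [mem_filter, mem_Ioc]

lemma card_filter_prime_le {T n : ℕ} (hn : n ≠ 0) :
    #{p ∈ Ioc T (2 * T) | p.Prime} ≤ #(coprimePrimes T n) + #n.primeFactors := by
  classical
  have e : #(coprimePrimes T n) = _ := card_subtype _ _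
  rw [e, filter_filter]
  refine (card_le_card fun p hp => ?_).trans (card_union_le _ _)
  obtain ⟨h1, h2⟩ := mem_filter.1 hp
  rw [mem_union, mem_filter, Nat.mem_primeFactors]
  tauto

lemma div_le_card_coprimePrimes {T n : ℕ} (hn : 1 ≤ Real.log n) (hT0 : 0 < T) (hTn : 2 * T ≤ n)
    (hT : (T : ℝ) / 4 ≤ #{p ∈ Ioc T (2 * T) | p.Prime} * Real.log (2 * T))
    (hlT : 24 * Real.log n ^ 2 ≤ T) :
    T / (8 * Real.log n) ≤ #(coprimePrimes T n) := by
  have h1 : (#{p ∈ Ioc T (2 * T) | p.Prime} : ℝ) ≤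
      #(coprimePrimes T n) + ((Nat.log 2 n + 1 : ℕ) : ℝ) := by
    exact_mod_cast (card_filter_prime_le (by omega)).trans
      (Nat.add_le_add_left (card_primeFactors_lt n).le _)
  have h2 := natLog_two_add_one_le hn
  have h3 : Real.log (2 * T) ≤ Real.log n := by
    refine Real.log_le_log (by positivity) ?_
    exact_mod_cast hTn
  have h4 := hT.trans (mul_le_mul_of_nonneg_left h3 (Nat.cast_nonneg _))
  have h5 := mul_le_mul_of_nonneg_right (h1.trans (add_le_add le_rfl h2))
    (by linarith : 0 ≤ Real.log n)
  rw [div_le_iff₀ (by linarith)]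
  nlinarith

lemma sq_div_four_le_card_lt (s : Finset Nat.Primes) (hs : 2 ≤ #s) :
    (#s : ℝ) ^ 2 / 4 ≤ #{x ∈ s ×ˢ s | (x.1 : ℕ) < x.2} := by
  classical
  have h1 : #s.offDiag ≤ 2 * #{x ∈ s ×ˢ s | (x.1 : ℕ) < x.2} := by
    calc #s.offDiag ≤ #({x ∈ s ×ˢ s | (x.1 : ℕ) < x.2} ∪
          ({x ∈ s ×ˢ s | (x.1 : ℕ) < x.2}).image Prod.swap) := by
          refine card_le_card fun x hx => ?_
          rw [mem_offDiag] at hx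
          obtain ⟨hx1, hx2, hne⟩ := hx
          rw [mem_union, mem_image]
          rcases lt_trichotomy (x.1 : ℕ) x.2 with h | h | h
          · exact Or.inl (by simp [hx1, hx2, h])
          · exact absurd (Nat.Primes.coe_nat_injective h) hne
          · exact Or.inr ⟨x.swap, by simp [hx1, hx2, h], by simp⟩
      _ ≤ _ := (card_union_le _ _).trans (by
          rw [two_mul]; exact Nat.add_le_add_left card_image_le _)
  rw [offDiag_card] at h1
  have h2 : (#s : ℝ) * #s ≤ 2 * #{x ∈ s ×ˢ s | (x.1 : ℕ) < x.2} + #s := by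
    exact_mod_cast (by omega : #s * #s ≤ 2 * #{x ∈ s ×ˢ s | (x.1 : ℕ) < x.2} + #s)
  have h3 : (2 : ℝ) ≤ #s := by exact_mod_cast hs
  nlinarith

lemma div_log_le_sum_log {k n : ℕ} (hn : 1 ≤ Real.log n) (hk : 3 ≤ k) (hkn : 2 * k ≤ n)
    (hnk : n ≤ 8 * k)
    (h : (k : ℝ) / 4 ≤ #{p ∈ Ioc k (2 * k) | p.Prime} * Real.log (2 * k)) :
    n / (32 * Real.log n) ≤ ∑ r ∈ Ioc k (2 * k) with r.Prime, Real.log r := by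
  have h3 : Real.log (2 * k) ≤ Real.log n := by
    refine Real.log_le_log (by positivity) ?_
    exact_mod_cast hkn
  have h4 := h.trans (mul_le_mul_of_nonneg_left h3 (Nat.cast_nonneg _))
  have h5 : (n : ℝ) ≤ 8 * k := by exact_mod_cast hnk
  have h6 : (#{p ∈ Ioc k (2 * k) | p.Prime} : ℝ) ≤
      ∑ r ∈ Ioc k (2 * k) with r.Prime, Real.log r := by
    rw [card_eq_sum_ones, Nat.cast_sum]
    refine sum_le_sum fun r hr => ?_
    have hr : 3 ≤ r := by
      have := (mem_Ioc.1 (mem_filter.1 hr).1).1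
      omega
    rw [Nat.cast_one, Real.le_log_iff_exp_le (by exact_mod_cast (by omega : 0 < r))]
    have h3 : (3 : ℝ) ≤ r := by exact_mod_cast hr
    exact (Real.exp_one_lt_d9.le.trans (by norm_num)).trans h3
  refine le_trans ?_ h6
  rw [div_le_iff₀ (by linarith)]
  linarith

lemma div_le_card_mul_sum_log_div {T k n : ℕ} (hn : 1 ≤ Real.log n) (hT0 : 0 < T)
    (hTn : 2 * T ≤ n) (hk : 3 ≤ k) (hkn : 2 * k ≤ n) (hnk : n ≤ 8 * k)
    (hT : (T : ℝ) / 4 ≤ #{p ∈ Ioc T (2 * T) | p.Prime} * Real.log (2 * T))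
    (hlT : 24 * Real.log n ^ 2 ≤ T)
    (h : (k : ℝ) / 4 ≤ #{p ∈ Ioc k (2 * k) | p.Prime} * Real.log (2 * k)) :
    n / (32768 * Real.log n ^ 3) ≤
      #{x ∈ coprimePrimes T n ×ˢ coprimePrimes T n | (x.1 : ℕ) < x.2} *
        (∑ r ∈ Ioc k (2 * k) with r.Prime, Real.log r) / (4 * T ^ 2) := by
  have hT' : (0 : ℝ) < T := by exact_mod_cast hT0
  have hl : 0 < Real.log n := by linarith
  have h1 := div_le_card_coprimePrimes hn hT0 hTn hT hlT
  have h2 : 2 ≤ #(coprimePrimes T n) := by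
    have : (2 : ℝ) ≤ T / (8 * Real.log n) := by
      rw [le_div_iff₀ (by linarith)]
      nlinarith
    exact_mod_cast this.trans h1
  have h3 := sq_div_four_le_card_lt _ h2
  have h4 := div_log_le_sum_log hn hk hkn hnk h
  calc (n : ℝ) / (32768 * Real.log n ^ 3) =
      (T / (8 * Real.log n)) ^ 2 / 4 * (n / (32 * Real.log n)) / (4 * T ^ 2) := by
        field_simp; ring
    _ ≤ _ := by
        gcongr
        exact (div_le_div_of_nonneg_right (pow_le_pow_left₀ (by positivity) h1 2)
          (by norm_num)).trans h3

lemma sieveConst_le {T n : ℕ} (hn : 1 ≤ Real.log n) (hT0 : 0 < T) (hTn : 2 * T ≤ n) :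
    sieveConst T ≤ 80 * Real.log n := by
  have : Real.log (((2 * T) ^ 4 : ℕ) : ℝ) ≤ 4 * Real.log n := by
    rw [Nat.cast_pow, Real.log_pow]
    have : Real.log ((2 * T : ℕ) : ℝ) ≤ Real.log n :=
      Real.log_le_log (by exact_mod_cast (by omega : 0 < 2 * T)) (by exact_mod_cast hTn)
    push_cast at this ⊢
    linarith
  unfold sieveConst
  linarith

lemma sieve_sqrt_le {ε δ x t w X : ℝ} (hx : 1 ≤ x) (hδ : δ ≤ ε) (hδ' : δ ≤ 1 / 2 - 2 * ε)
    (hε : 0 < ε) (ht : t ≤ x ^ (1 / 4 - ε)) (ht' : x ^ (1 / 4 - ε) / 2 ≤ t)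
    (hw : x ^ (1 / 4 : ℝ) ≤ w) (hX0 : 0 ≤ X) (hX : X ≤ x) :
    √(16 * X ^ 2 / t ^ 2 + 24 * X ^ 2 * t / w + 4 * X * t ^ 4) ≤ 10 * x ^ (1 - δ / 2) := by
  have hx0 : 0 < x := by linarith
  have hp (a : ℝ) : 0 < x ^ a := Real.rpow_pos_of_pos hx0 a
  have ht0 : 0 < t := (half_pos (hp _)).trans_le ht'
  have hw0 : 0 < w := (hp _).trans_le hw
  have hmono {a : ℝ} (ha : a ≤ 2 - δ) : x ^ a ≤ x ^ (2 - δ) :=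
    Real.rpow_le_rpow_of_exponent_le hx ha
  have h1 : 16 * X ^ 2 / t ^ 2 ≤ 64 * x ^ (2 - δ) := by
    calc 16 * X ^ 2 / t ^ 2 ≤ 16 * x ^ 2 / (x ^ (1 / 4 - ε) / 2) ^ 2 := by
          have := hp (1 / 4 - ε)
          gcongr
      _ = 64 * x ^ (2 - (1 / 4 - ε) * 2) := by
          rw [Real.rpow_sub hx0 2, Real.rpow_mul hx0.le, Real.rpow_two, Real.rpow_two]
          field_simp
          norm_num
      _ ≤ _ := by gcongr 64 * ?_; exact hmono (by linarith)
  have h2 : 24 * X ^ 2 * t / w ≤ 24 * x ^ (2 - δ) := by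
    calc 24 * X ^ 2 * t / w ≤ 24 * x ^ 2 * x ^ (1 / 4 - ε) / x ^ (1 / 4 : ℝ) := by
          have := hp (1 / 4)
          gcongr
      _ = 24 * x ^ (2 + (1 / 4 - ε) - 1 / 4) := by
          rw [Real.rpow_sub hx0 (2 + _), Real.rpow_add hx0, Real.rpow_two]
          ring
      _ ≤ _ := by gcongr 24 * ?_; exact hmono (by linarith)
  have h3 : 4 * X * t ^ 4 ≤ 4 * x ^ (2 - δ) := by
    calc 4 * X * t ^ 4 ≤ 4 * x * (x ^ (1 / 4 - ε)) ^ 4 := by gcongr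
      _ = 4 * x ^ (1 + (1 / 4 - ε) * 4) := by
          rw [Real.rpow_add hx0, Real.rpow_mul hx0.le, Real.rpow_one, Real.rpow_ofNat]
          ring
      _ ≤ _ := by gcongr 4 * ?_; exact hmono (by linarith)
  refine Real.sqrt_le_iff.2 ⟨by have := hp (1 - δ / 2); positivity, ?_⟩
  have e : (10 * x ^ (1 - δ / 2)) ^ 2 = 100 * x ^ (2 - δ) := by
    rw [mul_pow, ← Real.rpow_two (x ^ _), ← Real.rpow_mul hx0.le,
      show (1 - δ / 2) * 2 = 2 - δ by ring]
    norm_num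
  rw [e]
  have := hp (2 - δ)
  linarith

lemma distributionError_le {ε δ : ℝ} {n T k W L : ℕ} (hδ : δ ≤ ε) (hδ' : δ ≤ 1 / 2 - 2 * ε)
    (hε : 0 < ε) (hn : 1 ≤ Real.log n) (hT0 : 0 < T) (hTn : 2 * T ≤ n)
    (ht : (T : ℝ) ≤ (n : ℝ) ^ (1 / 4 - ε)) (ht' : (n : ℝ) ^ (1 / 4 - ε) / 2 ≤ T)
    (hw : (n : ℝ) ^ (1 / 4 : ℝ) ≤ W) (hw' : W ≤ 2 * (n : ℝ) ^ (1 / 4 : ℝ)) (hk0 : 0 < k)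
    (hk : 2 * k ≤ n) (hL : L ≤ 3 * Real.log n) :
    distributionError T k W L ≤ 14506 * Real.log n ^ 4 * (n : ℝ) ^ (1 - δ / 2) := by
  have hX : (2 * k : ℝ) ≤ n := by exact_mod_cast hk
  have hk' : (0 : ℝ) < k := by exact_mod_cast hk0
  have hx : (1 : ℝ) ≤ n := by exact_mod_cast (by omega : 1 ≤ n)
  set x : ℝ := (n : ℝ)
  have hx0 : 0 < x := by linarith
  have hp (a : ℝ) : 0 < x ^ a := Real.rpow_pos_of_pos hx0 a
  have hlog : Real.log (2 * k) ≤ Real.log x := Real.log_le_log (by positivity) hX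
  have hlog0 : 0 ≤ Real.log (2 * k) := by exact_mod_cast Real.log_natCast_nonneg (2 * k)
  have hS := sieveConst_le hn hT0 hTn
  have hS0 := sieveConst_nonneg T
  have hsq := sieve_sqrt_le hx hδ hδ' hε ht ht' hw (by positivity) hX
  set ℓ := Real.log x
  have hl0 : 0 ≤ ℓ := by linarith
  set E := x ^ (1 - δ / 2)
  have hE : 0 ≤ E := (hp _).le
  have hl4 : ℓ ≤ ℓ ^ 4 := le_self_pow₀ hn (by norm_num)
  have h1 : T ^ 2 * (13 * W ^ 2 * Real.log (2 * k)) ≤ 52 * ℓ ^ 4 * E := by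
    calc T ^ 2 * (13 * W ^ 2 * Real.log (2 * k)) ≤
          (x ^ (1 / 4 - ε)) ^ 2 * (13 * (2 * x ^ (1 / 4 : ℝ)) ^ 2 * ℓ) := by
          gcongr
      _ = 52 * ℓ * x ^ ((1 / 4 - ε) * 2 + 1 / 4 * 2) := by
          rw [Real.rpow_add hx0, Real.rpow_mul hx0.le, Real.rpow_mul hx0.le, Real.rpow_two,
            Real.rpow_two]
          ring
      _ ≤ 52 * ℓ ^ 4 * E := by
          gcongr 52 * ?_ * ?_
          exact Real.rpow_le_rpow_of_exponent_le hx (by linarith)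
  have h2 : L ^ 2 * (sieveConst T * Real.log (2 * k) * √(16 * (2 * k) ^ 2 / T ^ 2 +
      24 * (2 * k) ^ 2 * T / W + 4 * (2 * k) * T ^ 4)) ≤ 7200 * ℓ ^ 4 * E := by
    calc _ ≤ (3 * ℓ) ^ 2 * (80 * ℓ * ℓ * (10 * E)) := by gcongr
      _ = _ := by ring
  have h3 : T ^ 2 * (2 * √(2 * k) * Real.log (2 * k)) ≤ 2 * ℓ ^ 4 * E := by
    calc T ^ 2 * (2 * √(2 * k) * Real.log (2 * k)) ≤
          (x ^ (1 / 4 - ε)) ^ 2 * (2 * √x * ℓ) := by gcongr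
      _ = 2 * ℓ * x ^ ((1 / 4 - ε) * 2 + 1 / 2) := by
          rw [Real.rpow_add hx0, Real.rpow_mul hx0.le, Real.rpow_two, ← Real.sqrt_eq_rpow]
          ring
      _ ≤ 2 * ℓ ^ 4 * E := by
          gcongr 2 * ?_ * ?_
          exact Real.rpow_le_rpow_of_exponent_le hx (by linarith)
  unfold distributionError
  linarith

open Filter

/-- For every real `ε` with `0 < ε < 1/4` there exists `N` such that for
every integer `n ≥ N` there exist distinct primes `p, q` in `[n^(1/4−ε), 2·n^(1/4−ε)]` and a
prime `r` with `n/4 ≤ r ≤ n/2`, such that `r ≡ n (mod p)` and `r ≡ 1 (mod q)`. -/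
theorem exists_primes_in_progression (ε : ℝ) (hε0 : 0 < ε) (hε1 : ε < 1 / 4) :
    ∃ N : ℕ, ∀ n : ℕ, N ≤ n →
      ∃ p q r : ℕ, Nat.Prime p ∧ Nat.Prime q ∧ Nat.Prime r ∧ p ≠ q ∧
        (n : ℝ) ^ ((1 : ℝ) / 4 - ε) ≤ (p : ℝ) ∧ (p : ℝ) ≤ 2 * (n : ℝ) ^ ((1 : ℝ) / 4 - ε) ∧
        (n : ℝ) ^ ((1 : ℝ) / 4 - ε) ≤ (q : ℝ) ∧ (q : ℝ) ≤ 2 * (n : ℝ) ^ ((1 : ℝ) / 4 - ε) ∧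
        (n : ℝ) / 4 ≤ (r : ℝ) ∧ (r : ℝ) ≤ (n : ℝ) / 2 ∧
        r % p = n % p ∧ r % q = 1 % q := by
  rw [← eventually_atTop]
  obtain ⟨δ, hδ0, hδ, hδ'⟩ : ∃ δ : ℝ, 0 < δ ∧ δ ≤ ε ∧ δ ≤ 1 / 2 - 2 * ε :=
    ⟨min ε (1 / 2 - 2 * ε), lt_min hε0 (by linarith), min_le_left _ _, min_le_right _ _⟩
  have hη : 0 < 1 / 4 - ε := by linarith
  have htend : Tendsto (fun n : ℕ => (n : ℝ) ^ (1 / 4 - ε)) atTop atTop :=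
    (tendsto_rpow_atTop hη).comp tendsto_natCast_atTop_atTop
  have hk : Tendsto (fun n : ℕ => n / 4) atTop atTop := Nat.tendsto_div_const_atTop (by norm_num)
  filter_upwards [eventually_ge_atTop 40, htend.eventually_ge_atTop 2,
    (Real.tendsto_log_atTop.comp tendsto_natCast_atTop_atTop).eventually_ge_atTop 1,
    (tendsto_nat_floor_atTop.comp htend).eventually eventually_card_primes_Ioc_ge,
    hk.eventually eventually_card_primes_Ioc_ge,
    eventually_const_mul_log_pow_lt 48 2 hη,
    eventually_const_mul_log_pow_lt (32768 * 3 * 14506) 7 (half_pos hδ0)]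
    with n hn40 hx2 hn hT hkn hlT hfin
  simp only [Function.comp] at hn hT
  by_contra! hcon
  set t : ℝ := (n : ℝ) ^ (1 / 4 - ε) with ht
  set T := ⌊t⌋₊ with hTdef
  set k := n / 4 with hkdef
  have hx1 : (1 : ℝ) ≤ n := by exact_mod_cast (by omega : 1 ≤ n)
  have hTt : (T : ℝ) ≤ t := Nat.floor_le (by linarith)
  have htT : t < T + 1 := Nat.lt_floor_add_one t
  have hT0 : 0 < T := Nat.floor_pos.2 (by linarith)
  have ht4 : t ^ 4 ≤ n := by
    rw [ht, ← Real.rpow_natCast, ← Real.rpow_mul (by linarith)]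
    calc (n : ℝ) ^ ((1 / 4 - ε) * (4 : ℕ)) ≤ (n : ℝ) ^ (1 : ℝ) :=
          Real.rpow_le_rpow_of_exponent_le hx1 (by push_cast; linarith)
      _ = n := Real.rpow_one _
  have hTk : 2 * T ≤ k := by
    have h4 : T ^ 4 ≤ n := by
      exact_mod_cast (pow_le_pow_left₀ (Nat.cast_nonneg T) hTt 4).trans ht4
    rcases Nat.lt_or_ge T 4 with h | h
    · omega
    · have : T * 4 ^ 3 ≤ T ^ 4 := by
        rw [pow_succ' T 3]
        gcongr
      omega
  have hW : (1 : ℝ) ≤ (n : ℝ) ^ (1 / 4 : ℝ) := Real.one_le_rpow hx1 (by norm_num)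
  set W := ⌈(n : ℝ) ^ (1 / 4 : ℝ)⌉₊ with hWdef
  have hWle : (n : ℝ) ^ (1 / 4 : ℝ) ≤ W := Nat.le_ceil _
  have hWle' : (W : ℝ) ≤ 2 * (n : ℝ) ^ (1 / 4 : ℝ) := by
    have := Nat.ceil_lt_add_one (by linarith : 0 ≤ (n : ℝ) ^ (1 / 4 : ℝ))
    linarith
  have hW1 : 1 ≤ W := Nat.ceil_pos.2 (by linarith)
  have hL : n < 2 ^ (Nat.log 2 n + 1) := Nat.lt_pow_succ_log_self one_lt_two n
  have hmem : ∀ p ∈ coprimePrimes T n, t ≤ (p : ℕ) ∧ ((p : ℕ) : ℝ) ≤ 2 * t := fun p hp => by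
    obtain ⟨⟨h1, h2⟩, -⟩ := mem_coprimePrimes.1 hp
    have h1' : (T : ℝ) + 1 ≤ (p : ℕ) := by exact_mod_cast h1
    have h2' : ((p : ℕ) : ℝ) ≤ 2 * T := by exact_mod_cast h2
    constructor <;> linarith
  have hup := card_mul_sum_log_le (W := W) (L := Nat.log 2 n + 1) hT0 hTk hW1 (by omega)
    (coprimePrimes T n) (fun p hp => (mem_coprimePrimes.1 hp).1)
    (fun p => if h : (n : ZMod p) = 0 then 1 else Units.mk0 (n : ZMod p) h) 1 (by
      rintro p hp q hq hpq r hr hrp ⟨h1, h2⟩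
      have hn0 : (n : ZMod p) ≠ 0 := by
        rw [Ne, ZMod.natCast_eq_zero_iff]
        exact (mem_coprimePrimes.1 hp).2
      rw [dif_neg hn0, Units.val_mk0, ZMod.natCast_eq_natCast_iff] at h1
      have h2' : (r : ZMod q) = ((1 : ℕ) : ZMod q) := by simpa using h2
      rw [ZMod.natCast_eq_natCast_iff] at h2'
      obtain ⟨hr1, hr2⟩ := mem_Ioc.1 hr
      have hr1' : (n : ℝ) ≤ 4 * r := by exact_mod_cast (by omega : n ≤ 4 * r)
      have hr2' : (2 * r : ℝ) ≤ n := by exact_mod_cast (by omega : 2 * r ≤ n)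
      exact hcon p q r p.2 q.2 hrp hpq.ne (hmem p hp).1 (hmem p hp).2 (hmem q hq).1 (hmem q hq).2
        (by linarith) (by linarith) h1 h2')
  have hlow := div_le_card_mul_sum_log_div hn hT0 (by omega) (by omega : 3 ≤ k) (by omega)
    (by omega) hT (by linarith) hkn
  have herr := distributionError_le (W := W) hδ hδ' hε0 hn hT0 (by omega) hTt (by linarith) hWle
    hWle' (by omega : 0 < k) (by omega) (natLog_two_add_one_le hn)
  have h := hlow.trans (hup.trans (mul_le_mul_of_nonneg_left herr (by norm_num)))
  have hl : 0 < Real.log n := by linarith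
  have hE : (0 : ℝ) < (n : ℝ) ^ (1 - δ / 2) := Real.rpow_pos_of_pos (by linarith) _
  rw [div_le_iff₀ (by positivity)] at h
  have hsplit : (n : ℝ) = (n : ℝ) ^ (δ / 2) * (n : ℝ) ^ (1 - δ / 2) := by
    rw [← Real.rpow_add (by linarith), add_sub_cancel, Real.rpow_one]
  have := mul_lt_mul_of_pos_right hfin hE
  rw [← hsplit] at this
  linarith
end

section
/- (Balog–Sárközy variant.) There exist absolute constants c > 0 and C > 0 such that for every integer N ≥ 2 and all sets A, B ⊆ {1, …, N} with #A · #B ≥ c · N · (log N)², one has max over a ∈ A, b ∈ B of P(|a − b|) ≥ C · (#A · #B)^(1/2) / log N. -/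
/-- `P(k)`: the largest prime divisor of `k`, with `P(0) = P(1) = 0`. -/
def maxPrimeFac (k : ℕ) : ℕ := k.primeFactors.sup id

/-- The additive character `t ↦ exp (2πit)`. -/
noncomputable def expChar (t : ℝ) : ℂ := Complex.exp ((2 * Real.pi * t : ℝ) * Complex.I)

lemma expChar_add (s t : ℝ) : expChar (s + t) = expChar s * expChar t := by
  simp only [expChar, ← Complex.exp_add]
  congr 1
  push_cast
  ring

lemma norm_expChar (t : ℝ) : ‖expChar t‖ = 1 := Complex.norm_exp_ofReal_mul_I _

lemma conj_expChar (t : ℝ) : (starRingEnd ℂ) (expChar t) = expChar (-t) := by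
  rw [expChar, expChar, ← Complex.exp_conj, map_mul, Complex.conj_ofReal, Complex.conj_I]
  congr 1
  push_cast
  ring

lemma expChar_natCast_mul (n : ℕ) (t : ℝ) : expChar (n * t) = expChar t ^ n := by
  simp only [expChar, ← Complex.exp_nat_mul]
  congr 1
  push_cast
  ring

lemma expChar_intCast (m : ℤ) : expChar m = 1 := by
  rw [expChar, ← Complex.exp_int_mul_two_pi_mul_I m]
  congr 1
  push_cast
  ring

/-- The Dirichlet kernel is `O(1 / ‖t‖)`, where `‖t‖` is the distance from `t` to `ℤ`. -/
lemma norm_sum_expChar_mul_le (M : ℕ) (t : ℝ) :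
    ‖∑ i ∈ Finset.range M, expChar (i * t)‖ * |t - round t| ≤ 1 := by
  set u := t - round t with hu
  have hu2 : |u| ≤ 1 / 2 := abs_sub_round t
  have ht : expChar t = expChar u := by
    rw [show t = u + (round t : ℤ) by rw [hu]; ring, expChar_add, expChar_intCast, mul_one]
  have h1 : ‖expChar t - 1‖ = 2 * |Real.sin (Real.pi * u)| := by
    rw [ht, expChar, mul_comm, Complex.norm_exp_I_mul_ofReal_sub_one, norm_mul, Real.norm_eq_abs,
      Real.norm_eq_abs, abs_two, mul_assoc, mul_div_cancel_left₀ _ two_ne_zero]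
  have h2 : 2 * |u| ≤ |Real.sin (Real.pi * u)| := by
    have := Real.mul_abs_le_abs_sin (x := Real.pi * u) (by
      rw [abs_mul, abs_of_pos Real.pi_pos]; nlinarith [Real.pi_pos])
    rw [abs_mul, abs_of_pos Real.pi_pos] at this
    convert this using 1
    field_simp
  have h3 : ‖∑ i ∈ Finset.range M, expChar (i * t)‖ * ‖expChar t - 1‖ ≤ 2 := by
    rw [← norm_mul]
    simp only [expChar_natCast_mul]
    rw [geom_sum_mul]
    refine (norm_sub_le _ _).trans ?_
    simp [norm_pow, norm_expChar]
    norm_num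
  rw [h1] at h3
  nlinarith [norm_nonneg (∑ i ∈ Finset.range M, expChar (i * t)), abs_nonneg u]

lemma norm_sum_expChar_mul_sq_le (M : ℕ) {K : ℝ} (hK : 0 ≤ K) (hKM : K ≤ M) (t : ℝ) :
    ‖∑ i ∈ Finset.range M, expChar (i * t)‖ ^ 2 ≤
      (M : ℝ) ^ 2 * (1 / max 1 |K * (t - round t)| ^ 2) := by
  have h1 : ‖∑ i ∈ Finset.range M, expChar (i * t)‖ ≤ M := by
    refine (norm_sum_le _ _).trans ?_
    simp [norm_expChar]
  have h2 := norm_sum_expChar_mul_le M t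
  have h3 := norm_nonneg (∑ i ∈ Finset.range M, expChar (i * t))
  have hmax : 0 < max 1 |K * (t - round t)| := lt_max_of_lt_left one_pos
  rw [mul_one_div, le_div_iff₀ (by positivity), ← mul_pow]
  refine pow_le_pow_left₀ (by positivity) ?_ 2
  rw [mul_max_of_nonneg _ _ h3, mul_one]
  refine max_le h1 ?_
  rw [abs_mul, abs_of_nonneg hK]
  nlinarith

lemma sum_one_div_max_sq_le_of_nonneg {ι : Type*} (S : Finset ι) (y : ι → ℝ)
    (hy : ∀ s ∈ S, 0 ≤ y s) (hsep : ∀ r ∈ S, ∀ s ∈ S, r ≠ s → 1 ≤ |y r - y s|) :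
    ∑ s ∈ S, 1 / max 1 (y s) ^ 2 ≤ 3 := by
  have hinj : Set.InjOn (fun s ↦ ⌊y s⌋₊) S := by
    intro r hr s hs h
    by_contra hne
    have := hsep r hr s hs hne
    have h' : ⌊y r⌋₊ = ⌊y s⌋₊ := h
    have a1 := Nat.floor_le (hy r hr)
    have a2 := Nat.floor_le (hy s hs)
    have b1 := Nat.lt_floor_add_one (y r)
    have b2 := Nat.lt_floor_add_one (y s)
    rw [h'] at a1 b1
    have : |y r - y s| < 1 := by rw [abs_lt]; constructor <;> linarith
    linarith
  have key : ∀ L : ℕ, ∑ k ∈ Finset.range (L + 1), 1 / max 1 (k : ℝ) ^ 2 ≤ 3 - 2 / (L + 1 : ℝ) := by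
    intro L
    induction L with
    | zero => norm_num
    | succ n ih =>
      rw [Finset.sum_range_succ]
      have hm : max 1 ((n + 1 : ℕ) : ℝ) = n + 1 := by
        push_cast
        exact max_eq_right (by linarith [n.cast_nonneg (α := ℝ)])
      rw [hm]
      have h : 1 / ((n : ℝ) + 1) ^ 2 ≤ 2 / (n + 1) - 2 / (n + 1 + 1) := by
        rw [div_sub_div _ _ (by positivity) (by positivity),
          div_le_div_iff₀ (by positivity) (by positivity)]
        nlinarith [n.cast_nonneg (α := ℝ), mul_nonneg n.cast_nonneg (n.cast_nonneg (α := ℝ)),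
          pow_nonneg (n.cast_nonneg (α := ℝ)) 3]
      push_cast
      linarith
  obtain ⟨L, hL⟩ := (S.image fun s ↦ ⌊y s⌋₊).exists_nat_subset_range
  calc ∑ s ∈ S, 1 / max 1 (y s) ^ 2 ≤ ∑ s ∈ S, 1 / max 1 (⌊y s⌋₊ : ℝ) ^ 2 := by
        refine Finset.sum_le_sum fun s hs ↦ ?_
        gcongr
        exact Nat.floor_le (hy s hs)
    _ = ∑ k ∈ S.image fun s ↦ ⌊y s⌋₊, 1 / max 1 (k : ℝ) ^ 2 := by
        rw [Finset.sum_image hinj]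
    _ ≤ ∑ k ∈ Finset.range (L + 1), 1 / max 1 (k : ℝ) ^ 2 :=
        Finset.sum_le_sum_of_subset_of_nonneg
          (hL.trans (Finset.range_mono (Nat.le_succ L))) fun _ _ _ ↦ by positivity
    _ ≤ 3 := (key L).trans (sub_le_self _ (by positivity))

lemma sum_one_div_max_abs_sq_le {ι : Type*} (S : Finset ι) (y : ι → ℝ)
    (hsep : ∀ r ∈ S, ∀ s ∈ S, r ≠ s → 1 ≤ |y r - y s|) :
    ∑ s ∈ S, 1 / max 1 |y s| ^ 2 ≤ 6 := by
  classical
  rw [← Finset.sum_filter_add_sum_filter_not S (fun s ↦ 0 ≤ y s)]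
  have h1 : ∑ s ∈ S with 0 ≤ y s, 1 / max 1 |y s| ^ 2 ≤ 3 := by
    rw [Finset.sum_congr rfl fun s hs ↦ by rw [abs_of_nonneg (Finset.mem_filter.1 hs).2]]
    exact sum_one_div_max_sq_le_of_nonneg _ _ (fun s hs ↦ (Finset.mem_filter.1 hs).2)
      fun r hr s hs ↦ hsep r (Finset.mem_filter.1 hr).1 s (Finset.mem_filter.1 hs).1
  have h2 : ∑ s ∈ S with ¬ 0 ≤ y s, 1 / max 1 |y s| ^ 2 ≤ 3 := by
    have hneg : ∀ s ∈ S.filter (fun s ↦ ¬ 0 ≤ y s), y s ≤ 0 := fun s hs ↦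
      (not_le.1 (Finset.mem_filter.1 hs).2).le
    rw [Finset.sum_congr rfl fun s hs ↦ by rw [abs_of_nonpos (hneg s hs)]]
    refine sum_one_div_max_sq_le_of_nonneg _ (fun s ↦ -y s)
      (fun s hs ↦ neg_nonneg.2 (hneg s hs)) fun r hr s hs hne ↦ ?_
    rw [← neg_sub', abs_neg]
    exact hsep r (Finset.mem_filter.1 hr).1 s (Finset.mem_filter.1 hs).1 hne
  linarith

lemma sum_norm_sum_expChar_sq_le {ι : Type*} (R : Finset ι) (x : ι → ℝ) (M : ℕ) {K : ℝ}
    (hK : 0 ≤ K) (hKM : K ≤ M)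
    (hsep : ∀ r ∈ R, ∀ s ∈ R, r ≠ s → ∀ m : ℤ, 1 ≤ K * |x r - x s - m|) (r : ι) :
    ∑ s ∈ R, ‖∑ i ∈ Finset.range M, expChar (i * (x s - x r))‖ ^ 2 ≤ 6 * (M : ℝ) ^ 2 := by
  calc _ ≤ ∑ s ∈ R, (M : ℝ) ^ 2 *
        (1 / max 1 |K * (x s - x r - round (x s - x r))| ^ 2) :=
        Finset.sum_le_sum fun s _ ↦ norm_sum_expChar_mul_sq_le M hK hKM _
    _ ≤ (M : ℝ) ^ 2 * 6 := by
        rw [← Finset.mul_sum]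
        refine mul_le_mul_of_nonneg_left (sum_one_div_max_abs_sq_le R _ fun s hs t ht hne ↦ ?_)
          (by positivity)
        have := hsep s hs t ht hne (round (x s - x r) - round (x t - x r))
        have e : x s - x r - round (x s - x r) - (x t - x r - round (x t - x r)) =
            x s - x t - (round (x s - x r) - round (x t - x r) : ℤ) := by
          push_cast
          ring
        rwa [← mul_sub, abs_mul, abs_of_nonneg hK, e]
    _ = _ := mul_comm _ _

lemma sum_sum_norm_sq_sum_expChar {ι : Type*} (R : Finset ι) (x : ι → ℝ) (c : ι → ℂ) (M : ℕ) :
    ((∑ i ∈ Finset.range M, ∑ j ∈ Finset.range M,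
        ‖∑ r ∈ R, c r * expChar (((i : ℝ) - j) * x r)‖ ^ 2 : ℝ) : ℂ) =
      ∑ r ∈ R, ∑ s ∈ R, (starRingEnd ℂ) (c r) * c s *
        (‖∑ i ∈ Finset.range M, expChar (i * (x s - x r))‖ ^ 2 : ℝ) := by
  have expand : ∀ i j : ℕ, ((‖∑ r ∈ R, c r * expChar (((i : ℝ) - j) * x r)‖ ^ 2 : ℝ) : ℂ) =
      ∑ r ∈ R, ∑ s ∈ R, (starRingEnd ℂ) (c r) * c s *
        (expChar (i * (x s - x r)) * (starRingEnd ℂ) (expChar (j * (x s - x r)))) := by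
    intro i j
    rw [Complex.ofReal_pow, ← Complex.conj_mul', map_sum, Finset.sum_mul_sum]
    refine Finset.sum_congr rfl fun r _ ↦ Finset.sum_congr rfl fun s _ ↦ ?_
    rw [map_mul, conj_expChar, conj_expChar, ← expChar_add, mul_mul_mul_comm, ← expChar_add]
    congr 2
    ring
  rw [Complex.ofReal_sum]
  simp only [Complex.ofReal_sum, expand]
  have step : ∀ r s, (starRingEnd ℂ) (c r) * c s *
        ((‖∑ i ∈ Finset.range M, expChar (i * (x s - x r))‖ ^ 2 : ℝ) : ℂ) =
      ∑ i ∈ Finset.range M, ∑ j ∈ Finset.range M, (starRingEnd ℂ) (c r) * c s *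
        (expChar (i * (x s - x r)) * (starRingEnd ℂ) (expChar (j * (x s - x r)))) := by
    intro r s
    rw [Complex.ofReal_pow, ← Complex.mul_conj', map_sum, Finset.sum_mul_sum, Finset.mul_sum]
    simp only [Finset.mul_sum]
  simp only [step]
  calc _ = ∑ i ∈ Finset.range M, ∑ r ∈ R, ∑ s ∈ R, ∑ j ∈ Finset.range M,
        (starRingEnd ℂ) (c r) * c s *
        (expChar (i * (x s - x r)) * (starRingEnd ℂ) (expChar (j * (x s - x r)))) := by
        refine Finset.sum_congr rfl fun i _ ↦ ?_
        rw [Finset.sum_comm]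
        exact Finset.sum_congr rfl fun r _ ↦ Finset.sum_comm
    _ = _ := by
        rw [Finset.sum_comm]
        exact Finset.sum_congr rfl fun r _ ↦ Finset.sum_comm

/-- The dual form of the large sieve inequality. -/
lemma dual_large_sieve {ι : Type*} (R : Finset ι) (x : ι → ℝ) (c : ι → ℂ) (N : ℕ) (hN : 0 < N)
    (hsep : ∀ r ∈ R, ∀ s ∈ R, r ≠ s → ∀ m : ℤ, 1 ≤ (N : ℝ) * |x r - x s - m|) :
    ∑ n ∈ Finset.Icc 1 N, ‖∑ r ∈ R, c r * expChar (n * x r)‖ ^ 2 ≤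
      24 * N * ∑ r ∈ R, ‖c r‖ ^ 2 := by
  set T : ℝ → ℝ := fun t ↦ ‖∑ r ∈ R, c r * expChar (t * x r)‖ ^ 2 with hT
  set D : ι → ι → ℝ :=
    fun r s ↦ ‖∑ i ∈ Finset.range (2 * N), expChar (i * (x s - x r))‖ ^ 2 with hD
  have hDsymm : ∀ r s, D r s = D s r := by
    intro r s
    simp only [hD]
    rw [← Complex.norm_conj, map_sum]
    congr 3
    funext i
    rw [conj_expChar]
    congr 1
    ring
  have hDsum : ∀ r, ∑ s ∈ R, D r s ≤ 24 * (N : ℝ) ^ 2 := fun r ↦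
    (sum_norm_sum_expChar_sq_le R x (2 * N) N.cast_nonneg
      (by push_cast; linarith [N.cast_nonneg (α := ℝ)]) hsep r).trans
      (le_of_eq (by push_cast; ring))
  have lower : (N : ℝ) * ∑ n ∈ Finset.Icc 1 N, T n ≤
      ∑ i ∈ Finset.range (2 * N), ∑ j ∈ Finset.range (2 * N), T ((i : ℝ) - j) := by
    rw [Finset.sum_comm]
    calc _ = ∑ j ∈ Finset.range N, ∑ n ∈ Finset.Icc 1 N, T n := by simp
      _ ≤ ∑ j ∈ Finset.range N, ∑ i ∈ Finset.range (2 * N), T ((i : ℝ) - j) := by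
          refine Finset.sum_le_sum fun j hj ↦ ?_
          have hj := Finset.mem_range.1 hj
          rw [show ∑ n ∈ Finset.Icc 1 N, T n =
              ∑ i ∈ (Finset.Icc 1 N).image (· + j), T ((i : ℝ) - j) by
            rw [Finset.sum_image fun _ _ _ _ h ↦ Nat.add_right_cancel h]
            simp]
          refine Finset.sum_le_sum_of_subset_of_nonneg ?_ fun _ _ _ ↦ by positivity
          intro i hi
          simp only [Finset.mem_image, Finset.mem_Icc, Finset.mem_range] at hi ⊢
          omega
      _ ≤ _ := Finset.sum_le_sum_of_subset_of_nonneg (Finset.range_mono (by omega))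
          fun _ _ _ ↦ Finset.sum_nonneg fun _ _ ↦ by positivity
  have upper : ∑ i ∈ Finset.range (2 * N), ∑ j ∈ Finset.range (2 * N), T ((i : ℝ) - j) ≤
      24 * (N : ℝ) ^ 2 * ∑ r ∈ R, ‖c r‖ ^ 2 := by
    have hnn : 0 ≤ ∑ i ∈ Finset.range (2 * N), ∑ j ∈ Finset.range (2 * N), T ((i : ℝ) - j) :=
      Finset.sum_nonneg fun _ _ ↦ Finset.sum_nonneg fun _ _ ↦ by positivity
    calc _ = ‖((∑ i ∈ Finset.range (2 * N), ∑ j ∈ Finset.range (2 * N), T ((i : ℝ) - j) : ℝ) :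
            ℂ)‖ := by rw [Complex.norm_real, Real.norm_of_nonneg hnn]
      _ ≤ ∑ r ∈ R, ∑ s ∈ R, ‖c r‖ * ‖c s‖ * D r s := by
          rw [sum_sum_norm_sq_sum_expChar]
          refine (norm_sum_le _ _).trans (Finset.sum_le_sum fun r _ ↦
            (norm_sum_le _ _).trans (Finset.sum_le_sum fun s _ ↦ le_of_eq ?_))
          rw [norm_mul, norm_mul, Complex.norm_conj, Complex.norm_real,
            Real.norm_of_nonneg (by positivity)]
      _ ≤ ∑ r ∈ R, ∑ s ∈ R, (‖c r‖ ^ 2 * D r s / 2 + ‖c s‖ ^ 2 * D s r / 2) := by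
          refine Finset.sum_le_sum fun r _ ↦ Finset.sum_le_sum fun s _ ↦ ?_
          rw [hDsymm s r]
          have : 0 ≤ D r s := by positivity
          nlinarith [mul_nonneg this (sq_nonneg (‖c r‖ - ‖c s‖))]
      _ = ∑ r ∈ R, ‖c r‖ ^ 2 * ∑ s ∈ R, D r s := by
          simp only [Finset.sum_add_distrib]
          rw [Finset.sum_comm (f := fun r s ↦ ‖c s‖ ^ 2 * D s r / 2), ← Finset.sum_add_distrib]
          refine Finset.sum_congr rfl fun r _ ↦ ?_
          rw [← Finset.sum_add_distrib, Finset.mul_sum]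
          exact Finset.sum_congr rfl fun s _ ↦ add_halves _
      _ ≤ ∑ r ∈ R, ‖c r‖ ^ 2 * (24 * (N : ℝ) ^ 2) := by
          gcongr with r _
          exact hDsum r
      _ = _ := by rw [← Finset.sum_mul, mul_comm]
  have hN' : (0 : ℝ) < N := by exact_mod_cast hN
  refine le_of_mul_le_mul_left ?_ hN'
  calc _ ≤ _ := lower.trans upper
    _ = _ := by ring

/-- The large sieve inequality, for frequencies that are `1 / N`-separated modulo `1`. -/
lemma large_sieve_s3 {ι : Type*} (R : Finset ι) (x : ι → ℝ) (N : ℕ) (hN : 0 < N)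
    (hsep : ∀ r ∈ R, ∀ s ∈ R, r ≠ s → ∀ m : ℤ, 1 ≤ (N : ℝ) * |x r - x s - m|)
    (A : Finset ℕ) (hA : A ⊆ Finset.Icc 1 N) (a : ℕ → ℂ) :
    ∑ r ∈ R, ‖∑ n ∈ A, a n * expChar (n * x r)‖ ^ 2 ≤ 24 * N * ∑ n ∈ A, ‖a n‖ ^ 2 := by
  set S : ι → ℂ := fun r ↦ ∑ n ∈ A, a n * expChar (n * x r) with hS
  set V := ∑ r ∈ R, ‖S r‖ ^ 2 with hV
  set W := ∑ n ∈ A, ‖a n‖ ^ 2 with hW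
  have hV0 : 0 ≤ V := Finset.sum_nonneg fun _ _ ↦ by positivity
  have hW0 : 0 ≤ W := Finset.sum_nonneg fun _ _ ↦ by positivity
  have hVeq : (V : ℂ) =
      ∑ n ∈ A, a n * ∑ r ∈ R, (starRingEnd ℂ) (S r) * expChar (n * x r) := by
    simp only [hV, Complex.ofReal_sum, Complex.ofReal_pow, ← Complex.conj_mul', Finset.mul_sum]
    rw [Finset.sum_comm]
    refine Finset.sum_congr rfl fun r _ ↦ ?_
    conv_lhs => rw [hS]
    rw [Finset.mul_sum]
    exact Finset.sum_congr rfl fun n _ ↦ by ring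
  have hdual : ∑ n ∈ A, ‖∑ r ∈ R, (starRingEnd ℂ) (S r) * expChar (n * x r)‖ ^ 2 ≤
      24 * N * V := by
    refine (Finset.sum_le_sum_of_subset_of_nonneg hA fun _ _ _ ↦ by positivity).trans
      ((dual_large_sieve R x (fun r ↦ (starRingEnd ℂ) (S r)) N hN hsep).trans (le_of_eq ?_))
    simp only [Complex.norm_conj, hV]
  have hVle : V ≤ ∑ n ∈ A, ‖a n‖ * ‖∑ r ∈ R, (starRingEnd ℂ) (S r) * expChar (n * x r)‖ := by
    rw [← Real.norm_of_nonneg hV0, ← Complex.norm_real, hVeq]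
    exact (norm_sum_le _ _).trans (le_of_eq (by simp only [norm_mul]))
  have hVsq : V ^ 2 ≤ W * (24 * N * V) :=
    (pow_le_pow_left₀ hV0 hVle 2).trans ((Finset.sum_mul_sq_le_sq_mul_sq _ _ _).trans
      (mul_le_mul_of_nonneg_left hdual hW0))
  rcases hV0.eq_or_lt with h | h
  · rw [← h]
    positivity
  · nlinarith

lemma expChar_eq_one_iff (t : ℝ) : expChar t = 1 ↔ ∃ m : ℤ, t = m := by
  constructor
  · intro h
    obtain ⟨m, hm⟩ := Complex.exp_eq_one_iff.1 h
    refine ⟨m, ?_⟩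
    have h' : ((2 * Real.pi * t : ℝ) : ℂ) = ((m * (2 * Real.pi) : ℝ) : ℂ) := by
      apply mul_right_cancel₀ Complex.I_ne_zero
      rw [hm]
      push_cast
      ring
    have h2 : (2 * Real.pi) * t = (2 * Real.pi) * m := by
      rw [Complex.ofReal_inj.1 h', mul_comm]
    exact mul_left_cancel₀ Real.two_pi_pos.ne' h2
  · rintro ⟨m, rfl⟩
    exact expChar_intCast m

lemma sum_expChar_div (p : ℕ) (hp : 0 < p) (d : ℤ) :
    ∑ k ∈ Finset.range p, expChar (k * (d / p)) = if (p : ℤ) ∣ d then (p : ℂ) else 0 := by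
  have hp' : (p : ℝ) ≠ 0 := by positivity
  have hone : expChar (d / p) = 1 ↔ (p : ℤ) ∣ d := by
    rw [expChar_eq_one_iff]
    refine exists_congr fun m ↦ ?_
    rw [div_eq_iff hp', mul_comm]
    exact_mod_cast Iff.rfl
  simp only [expChar_natCast_mul]
  split_ifs with h
  · simp [hone.2 h]
  · rw [← hone] at h
    have hpow : expChar (d / p) ^ p = 1 := by
      rw [← expChar_natCast_mul, mul_div_cancel₀ _ hp', expChar_intCast]
    rw [geom_sum_eq h, hpow, sub_self, zero_div]

lemma card_mul_card_le_of_dvd_imp_eq (p : ℕ) (hp : 0 < p) (A B : Finset ℕ)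
    (hAB : ∀ a ∈ A, ∀ b ∈ B, (p : ℤ) ∣ (a : ℤ) - b → a = b) :
    (A.card : ℝ) * B.card ≤ p * (A ∩ B).card +
      ∑ k ∈ Finset.Ico 1 p,
        ‖∑ a ∈ A, expChar (a * (k / p))‖ * ‖∑ b ∈ B, expChar (b * (k / p))‖ := by
  set f : ℕ → ℂ := fun k ↦
    (∑ a ∈ A, expChar (a * (k / p))) * (starRingEnd ℂ) (∑ b ∈ B, expChar (b * (k / p))) with hf
  have hsum : ∑ k ∈ Finset.range p, f k = p * (A ∩ B).card := by
    have hfk : ∀ k, f k = ∑ a ∈ A, ∑ b ∈ B, expChar (k * (((a : ℤ) - b : ℤ) / p)) := by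
      intro k
      simp only [hf, map_sum, Finset.sum_mul_sum, conj_expChar, ← expChar_add]
      refine Finset.sum_congr rfl fun a _ ↦ Finset.sum_congr rfl fun b _ ↦ ?_
      congr 1
      push_cast
      ring
    simp only [hfk]
    rw [Finset.sum_comm]
    calc _ = ∑ a ∈ A, ∑ b ∈ B, if a = b then (p : ℂ) else 0 := by
          refine Finset.sum_congr rfl fun a ha ↦ ?_
          rw [Finset.sum_comm]
          refine Finset.sum_congr rfl fun b hb ↦ ?_
          rw [sum_expChar_div p hp]
          refine if_congr ⟨hAB a ha b hb, ?_⟩ rfl rfl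
          rintro rfl
          simp
      _ = _ := by
          simp [Finset.sum_ite_mem, mul_comm]
  have hzero : f 0 = A.card * B.card := by simp [hf, expChar]
  rw [Finset.range_eq_Ico, Finset.sum_eq_sum_Ico_succ_bot hp, hzero] at hsum
  have heq : ((A.card : ℂ) * B.card) = p * (A ∩ B).card - ∑ k ∈ Finset.Ico (0 + 1) p, f k := by
    rw [← hsum]
    ring
  calc (A.card : ℝ) * B.card = ‖(A.card : ℂ) * B.card‖ := by simp
    _ ≤ ‖(p : ℂ) * (A ∩ B).card‖ + ‖∑ k ∈ Finset.Ico 1 p, f k‖ := by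
        rw [heq]
        exact norm_sub_le _ _
    _ ≤ _ := by
        refine add_le_add (le_of_eq (by simp)) ((norm_sum_le _ _).trans (le_of_eq ?_))
        simp only [hf, norm_mul, Complex.norm_conj]

/-- Distinct reduced fractions with prime denominators at most `Q` are `1 / Q ^ 2`-separated
modulo `1`. -/
lemma one_le_sq_mul_abs_div_sub_div {p q k l Q : ℕ} (hp : p.Prime) (hq : q.Prime) (hpQ : p ≤ Q)
    (hqQ : q ≤ Q) (hk : 1 ≤ k) (hkp : k < p) (hl : 1 ≤ l) (hlq : l < q)
    (hne : ¬ (p = q ∧ k = l)) (m : ℤ) :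
    1 ≤ ((Q ^ 2 : ℕ) : ℝ) * |(k / p - l / q - m : ℝ)| := by
  have hp0 : (0 : ℝ) < p := by exact_mod_cast hp.pos
  have hq0 : (0 : ℝ) < q := by exact_mod_cast hq.pos
  have hz : (k * q - l * p - m * p * q : ℤ) ≠ 0 := by
    intro h
    by_cases hpq : p = q
    · subst hpq
      have hp' : (p : ℤ) ≠ 0 := by exact_mod_cast hp.ne_zero
      have h1 : (k : ℤ) - l = m * p := by
        apply mul_right_cancel₀ hp'
        linarith
      have h2 : (k : ℤ) - l = 0 := by
        apply Int.eq_zero_of_abs_lt_dvd (m := p) ⟨m, by rw [h1, mul_comm]⟩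
        rw [abs_lt]
        constructor <;> omega
      exact hne ⟨rfl, by omega⟩
    · have h1 : (p : ℤ) ∣ (k * q : ℕ) := ⟨l + m * q, by push_cast; linarith⟩
      have h2 := (hp.dvd_mul).1 (Int.natCast_dvd_natCast.1 h1)
      rcases h2 with h2 | h2
      · exact absurd (Nat.le_of_dvd hk h2) (by omega)
      · exact hpq ((Nat.prime_dvd_prime_iff_eq hp hq).1 h2)
  have hz1 : (1 : ℝ) ≤ |((k * q - l * p - m * p * q : ℤ) : ℝ)| := by
    exact_mod_cast Int.one_le_abs hz
  have heq : (k / p - l / q - m : ℝ) = ((k * q - l * p - m * p * q : ℤ) : ℝ) / (p * q) := by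
    push_cast
    field_simp
  have hpq : (p * q : ℝ) ≤ (Q ^ 2 : ℕ) := by
    have := Nat.mul_le_mul hpQ hqQ
    rw [sq]
    exact_mod_cast this
  rw [heq, abs_div, abs_of_pos (mul_pos hp0 hq0), ← mul_div_assoc, le_div_iff₀ (by positivity)]
  nlinarith [mul_pos hp0 hq0]

/-- If no two distinct elements of `A` and `B` are congruent modulo any of the primes in `P`, then
the large sieve bounds the product of the cardinalities of `A` and `B`. -/
lemma card_mul_card_mul_card_le {Q : ℕ} (hQ : 0 < Q) (P A B : Finset ℕ)
    (hP : ∀ p ∈ P, p.Prime ∧ p ≤ Q) (hA : A ⊆ Finset.Icc 1 (Q ^ 2))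
    (hB : B ⊆ Finset.Icc 1 (Q ^ 2))
    (hAB : ∀ p ∈ P, ∀ a ∈ A, ∀ b ∈ B, (p : ℤ) ∣ (a : ℤ) - b → a = b) :
    (P.card : ℝ) * (A.card * B.card) ≤
      P.card * (Q * √(A.card * B.card)) + 24 * Q ^ 2 * √(A.card * B.card) := by
  set R : Finset (Σ _ : ℕ, ℕ) := P.sigma fun p ↦ Finset.Ico 1 p with hR
  set x : (Σ _ : ℕ, ℕ) → ℝ := fun r ↦ r.2 / r.1 with hx
  have hsep : ∀ r ∈ R, ∀ s ∈ R, r ≠ s → ∀ m : ℤ,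
      1 ≤ ((Q ^ 2 : ℕ) : ℝ) * |x r - x s - m| := by
    rintro ⟨p, k⟩ hr ⟨q, l⟩ hs hne m
    simp only [hR, Finset.mem_sigma, Finset.mem_Ico] at hr hs
    refine one_le_sq_mul_abs_div_sub_div (hP p hr.1).1 (hP q hs.1).1 (hP p hr.1).2 (hP q hs.1).2
      hr.2.1 hr.2.2 hs.2.1 hs.2.2 ?_ m
    rintro ⟨rfl, rfl⟩
    exact hne rfl
  have sieve : ∀ E : Finset ℕ, E ⊆ Finset.Icc 1 (Q ^ 2) →
      ∑ r ∈ R, ‖∑ n ∈ E, expChar (n * x r)‖ ^ 2 ≤ 24 * Q ^ 2 * E.card := by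
    intro E hE
    simpa using large_sieve_s3 R x (Q ^ 2) (by positivity) hsep E hE 1
  have hcs : ∑ r ∈ R, ‖∑ a ∈ A, expChar (a * x r)‖ * ‖∑ b ∈ B, expChar (b * x r)‖ ≤
      24 * Q ^ 2 * √(A.card * B.card) := by
    refine abs_le_of_sq_le_sq' ?_ (by positivity) |>.2
    rw [mul_pow, Real.sq_sqrt (by positivity)]
    refine (Finset.sum_mul_sq_le_sq_mul_sq _ _ _).trans
      ((mul_le_mul (sieve A hA) (sieve B hB) (Finset.sum_nonneg fun _ _ ↦ by positivity)
        (by positivity)).trans (le_of_eq (by ring)))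
  have hinter : ((A ∩ B).card : ℝ) ≤ √(A.card * B.card) := by
    refine Real.le_sqrt_of_sq_le ?_
    rw [sq]
    gcongr
    · exact Finset.inter_subset_left
    · exact Finset.inter_subset_right
  calc (P.card : ℝ) * (A.card * B.card) = ∑ p ∈ P, (A.card * B.card : ℝ) := by simp
    _ ≤ ∑ p ∈ P, (Q * √(A.card * B.card) + ∑ k ∈ Finset.Ico 1 p,
          ‖∑ a ∈ A, expChar (a * (k / p))‖ * ‖∑ b ∈ B, expChar (b * (k / p))‖) := by
        refine Finset.sum_le_sum fun p hp ↦
          (card_mul_card_le_of_dvd_imp_eq p (hP p hp).1.pos A B (hAB p hp)).trans ?_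
        gcongr
        exact (hP p hp).2
    _ = P.card * (Q * √(A.card * B.card)) +
          ∑ r ∈ R, ‖∑ a ∈ A, expChar (a * x r)‖ * ‖∑ b ∈ B, expChar (b * x r)‖ := by
        rw [Finset.sum_add_distrib, hR, Finset.sum_sigma]
        simp [hx]
    _ ≤ _ := by gcongr

/-- Chebyshev's lower bound for `θ`, in a form with a convenient constant. -/
lemma eventually_half_le_theta :
    ∃ X : ℕ, ∀ n : ℕ, X ≤ n → (n : ℝ) / 2 ≤ Chebyshev.theta n := by
  have h1 : (fun x : ℝ ↦ Real.log (x + 1) + 2 * √x * Real.log x) =o[Filter.atTop]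
      (fun x : ℝ ↦ x) := by
    refine Asymptotics.IsLittleO.add ?_ ?_
    · refine (Real.isLittleO_log_id_atTop.comp_tendsto
        (Filter.tendsto_atTop_add_const_right _ 1 Filter.tendsto_id)).trans_isBigO ?_
      refine Asymptotics.IsBigO.of_bound 2 ?_
      filter_upwards [Filter.eventually_ge_atTop 1] with x hx
      simp only [Function.comp_apply, id, Real.norm_eq_abs]
      rw [abs_of_nonneg (by linarith), abs_of_nonneg (by linarith)]
      linarith
    · have hlog := isLittleO_log_rpow_atTop (r := 1 / 2) (by norm_num)
      simp only [← Real.sqrt_eq_rpow] at hlog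
      refine (((Asymptotics.isBigO_refl (fun x : ℝ ↦ √x) Filter.atTop).const_mul_left
        2).mul_isLittleO hlog).congr' Filter.EventuallyEq.rfl ?_
      filter_upwards [Filter.eventually_ge_atTop 0] with x hx
      exact Real.mul_self_sqrt hx
  have h2 := (h1.comp_tendsto tendsto_natCast_atTop_atTop).bound (c := 1 / 10) (by norm_num)
  obtain ⟨X, hX⟩ := Filter.eventually_atTop.1 h2
  refine ⟨X, fun n hn ↦ ?_⟩
  have h3 := (le_abs_self _).trans (hX n hn)
  have h4 := Chebyshev.theta_ge n
  simp only [Function.comp_apply, Real.norm_eq_abs, Nat.abs_cast] at h3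
  have := Real.log_two_gt_d9
  nlinarith [n.cast_nonneg (α := ℝ)]

/-- A lower bound of the right order for the number of primes in `(y, Q]`. -/
lemma quarter_le_card_primes_mul_log {Q : ℕ} (hθ : (Q : ℝ) / 2 ≤ Chebyshev.theta Q)
    {y : ℝ} (hy : 0 ≤ y) (hyQ : 8 * y ≤ Q) :
    (Q : ℝ) / 4 ≤
      ((Finset.Ioc 0 Q).filter fun p : ℕ ↦ p.Prime ∧ y < p).card * Real.log Q := by
  have h1 := Chebyshev.theta_le_log4_mul_x hy
  have hlog : Real.log 4 ≤ 2 := by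
    rw [show (4 : ℝ) = 2 ^ 2 by norm_num, Real.log_pow]
    have := Real.log_two_lt_d9
    push_cast
    linarith
  have h2 : Chebyshev.theta Q ≤ Chebyshev.theta y +
      ∑ p ∈ (Finset.Ioc 0 Q).filter (fun p : ℕ ↦ p.Prime ∧ y < p), Real.log p := by
    rw [Chebyshev.theta, Chebyshev.theta, Nat.floor_natCast,
      ← Finset.sum_filter_not_add_sum_filter _ (fun p : ℕ ↦ y < p), Finset.filter_filter,
      Finset.filter_filter]
    gcongr ?_ + _
    refine Finset.sum_le_sum_of_subset_of_nonneg (fun p hp ↦ ?_)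
      fun p _ _ ↦ Real.log_natCast_nonneg p
    simp only [Finset.mem_filter, Finset.mem_Ioc, not_lt] at hp ⊢
    exact ⟨⟨hp.1.1, Nat.le_floor hp.2.2⟩, hp.2.1⟩
  have h3 : ∑ p ∈ (Finset.Ioc 0 Q).filter (fun p : ℕ ↦ p.Prime ∧ y < p), Real.log p ≤
      ((Finset.Ioc 0 Q).filter fun p : ℕ ↦ p.Prime ∧ y < p).card * Real.log Q := by
    rw [← nsmul_eq_mul]
    refine Finset.sum_le_card_nsmul _ _ _ fun p hp ↦ ?_
    simp only [Finset.mem_filter, Finset.mem_Ioc] at hp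
    exact Real.log_le_log (by exact_mod_cast hp.1.1) (by exact_mod_cast hp.1.2)
  nlinarith

lemma le_maxPrimeFac {p k : ℕ} (hp : p.Prime) (hpk : p ∣ k) (hk : k ≠ 0) : p ≤ maxPrimeFac k :=
  Finset.le_sup (f := id) (Nat.mem_primeFactors.2 ⟨hp, hpk, hk⟩)

/-- The size bound obtained by playing a sieve bound `key` against a lower bound `hn` for the
number of sieving primes. -/
lemma le_mul_of_sieve_bounds {n Q S L : ℝ} (hn0 : 0 ≤ n) (hQ : 0 < Q) (hS : 0 < S) (hL : 0 ≤ L)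
    (hQS : Q ≤ S / 2) (hn : Q / 4 ≤ n * L) (key : n * S ^ 2 ≤ n * (Q * S) + 24 * Q ^ 2 * S) :
    S ≤ 192 * L * Q := by
  have h1 : n * S ≤ 48 * Q ^ 2 := by
    have h2 : n * (Q * S) ≤ n * (S / 2 * S) := by gcongr
    refine le_of_mul_le_mul_right ?_ hS
    linarith
  have h2 : Q / 4 * S ≤ 48 * Q ^ 2 * L :=
    calc Q / 4 * S ≤ n * L * S := by gcongr
      _ = n * S * L := by ring
      _ ≤ _ := by gcongr
  refine le_of_mul_le_mul_left ?_ hQ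
  linarith

/-- **Balog–Sárközy variant.** There exist absolute constants `c > 0` and
`C > 0` such that for every integer `N ≥ 2` and all sets `A, B ⊆ {1, …, N}` with
`#A·#B ≥ c·N·(log N)²`, one has `max_{a ∈ A, b ∈ B} P(|a − b|) ≥ C·(#A·#B)^(1/2)/log N`. -/
theorem balog_sarkozy :
    ∃ c C : ℝ, 0 < c ∧ 0 < C ∧ ∀ N : ℕ, 2 ≤ N → ∀ A B : Finset ℕ,
      A ⊆ Finset.Icc 1 N → B ⊆ Finset.Icc 1 N →
      c * (N : ℝ) * Real.log N ^ 2 ≤ (A.card : ℝ) * (B.card : ℝ) →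
      ∃ a ∈ A, ∃ b ∈ B,
        C * ((A.card : ℝ) * (B.card : ℝ)) ^ ((1 : ℝ) / 2) / Real.log N ≤
          (maxPrimeFac ((a : ℤ) - (b : ℤ)).natAbs : ℝ) := by
  obtain ⟨X, hX⟩ := eventually_half_le_theta
  refine ⟨(200 * (X + 2)) ^ 2, 1 / 3200, by positivity, by norm_num, ?_⟩
  intro N hN A B hA hB hc
  rw [← Real.sqrt_eq_rpow]
  set S : ℝ := √((A.card : ℝ) * B.card) with hS
  set L : ℝ := Real.log N with hL
  by_contra! hsmall
  have hSsq : S ^ 2 = (A.card : ℝ) * B.card := Real.sq_sqrt (by positivity)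
  have hN1 : (2 : ℝ) ≤ N := by exact_mod_cast hN
  have hL2 : 1 / 2 ≤ L :=
    (by linarith [Real.log_two_gt_d9] : 1 / 2 ≤ Real.log 2).trans
      (Real.log_le_log two_pos hN1)
  have hSN : S ≤ N := by
    have hcard : ∀ E : Finset ℕ, E ⊆ Finset.Icc 1 N → (E.card : ℝ) ≤ N := fun E hE ↦ by
      exact_mod_cast (Finset.card_le_card hE).trans (by simp)
    refine abs_le_of_sq_le_sq' ?_ (by positivity) |>.2
    rw [hSsq, sq]
    exact mul_le_mul (hcard A hA) (hcard B hB) (by positivity) (by positivity)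
  set w : ℝ := S / (200 * L) with hw
  have hwS : 200 * L * w = S := by
    rw [hw]
    field_simp
  have hwN : ((X : ℝ) + 2) ^ 2 * N ≤ w ^ 2 := by
    rw [hw, div_pow, hSsq, le_div_iff₀ (by positivity)]
    linarith
  have hw0 : 0 ≤ w := by positivity
  have hwX : (X : ℝ) + 2 ≤ w := by
    refine abs_le_of_sq_le_sq' ?_ hw0 |>.2
    nlinarith [sq_nonneg ((X : ℝ) + 2)]
  set Q : ℕ := ⌊w⌋₊ with hQ
  have hQw : (Q : ℝ) ≤ w := Nat.floor_le hw0
  have hwQ : w < Q + 1 := Nat.lt_floor_add_one w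
  have hX0 : (0 : ℝ) ≤ X := X.cast_nonneg
  have hQ1 : (1 : ℝ) < Q := by linarith
  have hQ0 : 0 < Q := by exact_mod_cast one_pos.trans hQ1
  have hXQ : X ≤ Q := by
    have : (X : ℝ) ≤ Q := by linarith
    exact_mod_cast this
  have hNQ : N ≤ Q ^ 2 := by
    have h1 : 4 * (N : ℝ) ≤ w ^ 2 :=
      (mul_le_mul_of_nonneg_right (by nlinarith) N.cast_nonneg).trans hwN
    have h2 : w ^ 2 ≤ (2 * Q : ℝ) ^ 2 := pow_le_pow_left₀ hw0 (by linarith) 2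
    have : (N : ℝ) ≤ (Q : ℝ) ^ 2 := by linarith
    exact_mod_cast this
  have hQS : (Q : ℝ) ≤ S / 2 := by
    have : 1 / 2 * w ≤ L * w := mul_le_mul_of_nonneg_right hL2 hw0
    linarith
  set y : ℝ := w / 16 with hy
  have hCy : 1 / 3200 * S / L = y := by
    rw [hy, hw]
    field_simp
    ring
  set P := (Finset.Ioc 0 Q).filter fun p : ℕ ↦ p.Prime ∧ y < p with hP
  have hPmem : ∀ p ∈ P, p.Prime ∧ p ≤ Q ∧ y < p := by
    intro p hp
    simp only [hP, Finset.mem_filter, Finset.mem_Ioc] at hp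
    exact ⟨hp.2.1, hp.1.2, hp.2.2⟩
  have hcount : (Q : ℝ) / 4 ≤ P.card * Real.log Q :=
    quarter_le_card_primes_mul_log (hX Q hXQ) (by positivity) (by linarith)
  have hlogQ : Real.log Q ≤ L := Real.log_le_log (by linarith) (by linarith)
  have hPL : (Q : ℝ) / 4 ≤ P.card * L :=
    hcount.trans (mul_le_mul_of_nonneg_left hlogQ (by positivity))
  have hIcc : Finset.Icc 1 N ⊆ Finset.Icc 1 (Q ^ 2) := Finset.Icc_subset_Icc_right hNQ
  have key := card_mul_card_mul_card_le hQ0 P A B (fun p hp ↦ ⟨(hPmem p hp).1, (hPmem p hp).2.1⟩)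
    (hA.trans hIcc) (hB.trans hIcc) fun p hp a ha b hb hdvd ↦ by
      by_contra hab
      have hlt := hsmall a ha b hb
      rw [hCy] at hlt
      have hle := le_maxPrimeFac (hPmem p hp).1 (Int.natCast_dvd.1 hdvd) (by omega)
      have : (p : ℝ) < y := lt_of_le_of_lt (by exact_mod_cast hle) hlt
      linarith [(hPmem p hp).2.2]
  rw [← hS, ← hSsq] at key
  have hS0 : 0 < S := by linarith
  have hfin : S ≤ 192 * L * Q :=
    le_mul_of_sieve_bounds P.card.cast_nonneg (by linarith) hS0 (by linarith) hQS hPL key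
  have hLw : L * Q ≤ L * w := mul_le_mul_of_nonneg_left hQw (by linarith)
  linarith
end
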